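/- Let G be a non-hamiltonian 1-tough graph on n ≥ 3 vertices with σ₃(G) ≥ n, C a longest cycle, u ∉ V(C), and v ∈ V(C) with v⁺, v⁻ ∈ N(u). Let A be the set of middle vertices of paths b x b' along C of length 2 with both endpoints b, b' in N(u). Then the sets (V(G)−V(C)) ∪ N(u)⁺ ∪ N(A)⁺ and (V(G)−V(C)) ∪ N(u)⁻ ∪ N(A)⁻ are both independent sets in G. -/

import Mathlib

open scoped Classical

namespace Paper

noncomputable section

variable {V : Type*}

/-- degree as cardinality of neighbor set -/
def deg (G : SimpleGraph V) (x : V) : ℕ := (G.neighborSet x).ncard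

/-- G is 1-tough -/
def OneTough (G : SimpleGraph V) : Prop :=
  ∀ S : Set V, S.Nonempty → Nat.card ((G.induce Sᶜ).ConnectedComponent) ≤ S.ncard

def IsIndepTriple (G : SimpleGraph V) (s : Finset V) : Prop :=
  s.card = 3 ∧ ∀ x ∈ s, ∀ y ∈ s, x ≠ y → ¬ G.Adj x y

def sigma3 [Fintype V] (G : SimpleGraph V) : ℕ :=
  if ∃ s : Finset V, IsIndepTriple G s then
    sInf {k | ∃ s : Finset V, IsIndepTriple G s ∧ ∑ x ∈ s, deg G x = k}
  else 3 * (Fintype.card V - 1)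

def NC2 [Fintype V] (G : SimpleGraph V) : ℕ :=
  if G = ⊤ then Fintype.card V - 1
  else sInf {k | ∃ x y : V, G.dist x y = 2 ∧ (G.neighborSet x ∪ G.neighborSet y).ncard = k}

def circumference (G : SimpleGraph V) : ℕ :=
  sSup {k | ∃ (a : V) (w : G.Walk a a), w.IsCycle ∧ w.length = k}

def IsLongestCycle (G : SimpleGraph V) {a : V} (c : G.Walk a a) : Prop :=
  c.IsCycle ∧ ∀ (b : V) (w : G.Walk b b), w.IsCycle → w.length ≤ c.length

/-- successor of a vertex along the oriented cycle `c` (identity off the cycle) -/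
def cSucc [DecidableEq V] {G : SimpleGraph V} {a : V} (c : G.Walk a a) (x : V) : V :=
  if h : x ∈ c.support.tail then c.support.tail.next x h else x

/-- predecessor of a vertex along the oriented cycle `c` (identity off the cycle) -/
def cPred [DecidableEq V] {G : SimpleGraph V} {a : V} (c : G.Walk a a) (x : V) : V :=
  if h : x ∈ c.support.tail then c.support.tail.prev x h else x

/-- vertices strictly between `x` and `y` going forward along `c` -/
def arc [DecidableEq V] {G : SimpleGraph V} {a : V} (c : G.Walk a a) (x y : V) : Set V :=
  {z | ∃ i k : ℕ, 0 < i ∧ i < k ∧ k < c.length ∧ (cSucc c)^[k] x = y ∧ z = (cSucc c)^[i] x}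

/-- length of the interval of the cycle `c` starting at `b` determined by `B` -/
def intervalLen [DecidableEq V] {G : SimpleGraph V} {a : V} (c : G.Walk a a)
    (B : Set V) (b : V) : ℕ :=
  sInf {k | 0 < k ∧ (cSucc c)^[k] b ∈ B}

/-- inner vertices of the interval of the cycle `c` starting at `b` determined by `B` -/
def innerVerts [DecidableEq V] {G : SimpleGraph V} {a : V} (c : G.Walk a a)
    (B : Set V) (b : V) : Set V :=
  {x | ∃ i, 0 < i ∧ i < intervalLen c B b ∧ x = (cSucc c)^[i] b}

/-- the union of the neighborhoods of the vertices in `S` -/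
def nbhdSet (G : SimpleGraph V) (S : Set V) : Set V := {z | ∃ y ∈ S, G.Adj y z}

/-- a set of vertices is independent -/
def IsIndepSet (G : SimpleGraph V) (S : Set V) : Prop :=
  ∀ x ∈ S, ∀ y ∈ S, ¬ G.Adj x y

/-- `f` is a bi-infinite periodic parametrization of a longest cycle of `G`, of length `L`. -/
structure IsLongestParam (G : SimpleGraph V) (L : ℤ) (f : ℤ → V) : Prop where
  three_le : 3 ≤ L
  adj : ∀ i, G.Adj (f i) (f (i + 1))
  per : ∀ i, f (i + L) = f i
  inj : ∀ i j, f i = f j → L ∣ i - j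
  le : ∀ (b : V) (w : G.Walk b b), w.IsCycle → (w.length : ℤ) ≤ L

/-- `x` is not on the parametrized cycle -/
def Off (f : ℤ → V) (x : V) : Prop := ∀ z, f z ≠ x

/-- There is a path from `a` to `b` with `k` vertices, each of which has the form `f z` with `I z`,
or lies off `f` and satisfies `W`. -/
def HasPath (G : SimpleGraph V) (f : ℤ → V) (I : ℤ → Prop) (W : V → Prop) (k : ℤ) (a b : V) :
    Prop :=
  ∃ p : G.Walk a b, p.IsPath ∧ (p.length : ℤ) + 1 = k ∧
    ∀ x ∈ p.support, (∃ z, I z ∧ f z = x) ∨ (W x ∧ Off f x)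

theorem HasPath.symm {G : SimpleGraph V} {f : ℤ → V} {I : ℤ → Prop} {W : V → Prop} {k : ℤ}
    {a b : V} (h : HasPath G f I W k a b) : HasPath G f I W k b a := by
  obtain ⟨p, hp, hk, hs⟩ := h
  exact ⟨p.reverse, hp.reverse, by simpa using hk, by simpa using hs⟩

theorem HasPath.pos {G : SimpleGraph V} {f : ℤ → V} {I : ℤ → Prop} {W : V → Prop} {k : ℤ}
    {a b : V} (h : HasPath G f I W k a b) : 1 ≤ k := by
  obtain ⟨p, hp, hk, hs⟩ := h
  omega

theorem HasPath.two_le {G : SimpleGraph V} {f : ℤ → V} {I : ℤ → Prop} {W : V → Prop} {k : ℤ}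
    {a b : V} (h : HasPath G f I W k a b) (hab : a ≠ b) : 2 ≤ k := by
  obtain ⟨p, hp, hk, hs⟩ := h
  have : p.length ≠ 0 := fun h0 => hab (SimpleGraph.Walk.eq_of_length_eq_zero h0)
  omega

theorem hasPath_single {G : SimpleGraph V} {f : ℤ → V} {x : V} (hx : Off f x) :
    HasPath G f (fun _ => False) (fun y => y = x) 1 x x :=
  ⟨.nil, .nil, by simp, by simp [hx]⟩

theorem HasPath.mono {G : SimpleGraph V} {f : ℤ → V} {I J : ℤ → Prop} {W W' : V → Prop} {k : ℤ}
    {a b : V} (h : HasPath G f I W k a b) (hI : ∀ z, I z → J z) (hW : ∀ x, W x → W' x) :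
    HasPath G f J W' k a b := by
  obtain ⟨p, hp, hk, hs⟩ := h
  refine ⟨p, hp, hk, fun x hx => ?_⟩
  rcases hs x hx with ⟨z, hz, hzx⟩ | h
  · exact Or.inl ⟨z, hI z hz, hzx⟩
  · exact Or.inr ⟨hW x h.1, h.2⟩

theorem exists_walk_append {G : SimpleGraph V} {a b c d : V} (p : G.Walk a b) (q : G.Walk c d)
    (hp : p.IsPath) (hq : q.IsPath) (hbc : G.Adj b c)
    (hdisj : ∀ x ∈ p.support, x ∉ q.support) :
    ∃ r : G.Walk a d, r.IsPath ∧ r.length = p.length + 1 + q.length ∧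
      ∀ x ∈ r.support, x ∈ p.support ∨ x ∈ q.support := by
  refine ⟨p.append (.cons hbc q), ?_, ?_, ?_⟩
  · rw [SimpleGraph.Walk.isPath_def, SimpleGraph.Walk.support_append]
    simp only [SimpleGraph.Walk.support_cons, List.tail_cons]
    exact List.nodup_append.2 ⟨hp.support_nodup, hq.support_nodup,
      fun x hx y hy hxy => hdisj x hx (hxy ▸ hy)⟩
  · simp [SimpleGraph.Walk.length_append]; omega
  · intro x hx
    rw [SimpleGraph.Walk.support_append] at hx
    simpa using hx

namespace IsLongestParam

variable {G : SimpleGraph V} {L : ℤ} {f : ℤ → V}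

theorem eq_of_window (hf : IsLongestParam G L f) {i j : ℤ} (h : f i = f j)
    (h1 : i < j + L) (h2 : j < i + L) : i = j := by
  obtain ⟨c, hc⟩ := hf.inj _ _ h
  have hL := hf.three_le
  have h3 : c < 1 := by by_contra hh; nlinarith
  have h4 : -1 < c := by by_contra hh; nlinarith
  have : c = 0 := by omega
  subst this
  omega

theorem per' (hf : IsLongestParam G L f) (i : ℤ) : f (i - L) = f i := by
  rw [← hf.per (i - L)]; congr 1; omega

theorem per_mul (hf : IsLongestParam G L f) (i c : ℤ) : f (i + c * L) = f i := by
  induction c using Int.induction_on with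
  | zero => simp
  | succ n ih => rw [← ih, ← hf.per (i + n * L)]; congr 1; ring
  | pred n ih => rw [← ih, ← hf.per' (i + -n * L)]; congr 1; ring

theorem window (hf : IsLongestParam G L f) (α i : ℤ) :
    ∃ j, α ≤ j ∧ j < α + L ∧ f j = f i := by
  have hL := hf.three_le
  refine ⟨α + (i - α) % L, ?_, ?_, ?_⟩
  · have := Int.emod_nonneg (i - α) (show L ≠ 0 by omega); omega
  · have := Int.emod_lt_of_pos (i - α) (show 0 < L by omega); omega
  · rw [← hf.per_mul _ ((i - α) / L)]
    congr 1
    have := Int.emod_add_mul_ediv (i - α) L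
    linarith [mul_comm L ((i - α) / L)]

theorem reflect (hf : IsLongestParam G L f) : IsLongestParam G L (fun i => f (-i)) where
  three_le := hf.three_le
  adj i := by
    have := (hf.adj (-(i + 1))).symm
    rwa [show -(i + 1) + 1 = -i by ring] at this
  per i := by
    rw [← hf.per (-(i + L))]; congr 1; ring
  inj i j h := by
    have := hf.inj _ _ h
    rw [show i - j = -(-i - -j) by ring]
    exact this.neg_right
  le := hf.le

theorem shift (hf : IsLongestParam G L f) (t : ℤ) : IsLongestParam G L (fun i => f (i + t)) where
  three_le := hf.three_le
  adj i := by
    have := hf.adj (i + t)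
    rwa [show i + t + 1 = i + 1 + t by ring] at this
  per i := by
    rw [← hf.per (i + t)]; congr 1; ring
  inj i j h := by
    have := hf.inj _ _ h
    rwa [show i - j = i + t - (j + t) by ring]
  le := hf.le

theorem hasPath_arc (hf : IsLongestParam G L f) {i j : ℤ} (hij : i ≤ j) (hj : j < i + L) :
    HasPath G f (fun z => i ≤ z ∧ z ≤ j) (fun _ => False) (j - i + 1) (f i) (f j) := by
  obtain ⟨n, rfl⟩ : ∃ n : ℕ, j = i + n := ⟨(j - i).toNat, by omega⟩
  clear hij
  induction n with
  | zero =>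
    refine ⟨SimpleGraph.Walk.nil.copy rfl (by simp), by simp, by simp, ?_⟩
    intro x hx
    simp only [SimpleGraph.Walk.support_copy, SimpleGraph.Walk.support_nil,
      List.mem_singleton] at hx
    exact Or.inl ⟨i, by simp, hx.symm⟩
  | succ n ih =>
    obtain ⟨p, hp, hk, hs⟩ := ih (by push_cast at hj; omega)
    have hadj : G.Adj (f (i + n)) (f (i + (n + 1 : ℕ))) := by
      have := hf.adj (i + n)
      rwa [show i + (n : ℤ) + 1 = i + (n + 1 : ℕ) by push_cast; ring] at this
    obtain ⟨r, hr, hrl, hrs⟩ := exists_walk_append p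
      (SimpleGraph.Walk.nil : G.Walk (f (i + (n + 1 : ℕ))) _) hp .nil hadj (by
        intro x hx hx'
        simp only [SimpleGraph.Walk.support_nil, List.mem_singleton] at hx'
        rcases hs x hx with ⟨z, hz, hzx⟩ | h
        · have := hf.eq_of_window (hzx.trans hx') (by omega) (by push_cast at *; omega)
          push_cast at this
          omega
        · exact h.1)
    refine ⟨r, hr, by rw [hrl]; push_cast at *; simp; omega, ?_⟩
    intro x hx
    left
    rcases hrs x hx with h | h
    · rcases hs x h with ⟨z, hz, hzx⟩ | h
      · exact ⟨z, by push_cast; omega, hzx⟩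
      · exact h.1.elim
    · simp only [SimpleGraph.Walk.support_nil, List.mem_singleton] at h
      exact ⟨_, by push_cast; omega, h.symm⟩

theorem hasPath_append (hf : IsLongestParam G L f) {I J : ℤ → Prop} {W W' : V → Prop} {k l : ℤ}
    {a b c d : V} (h : HasPath G f I W k a b) (hbc : G.Adj b c) (h' : HasPath G f J W' l c d)
    (hI : ∀ z z', I z → J z' → (z < z' ∧ z' < z + L) ∨ (z' < z ∧ z < z' + L))
    (hW : ∀ x, W x → ¬ W' x) :
    HasPath G f (fun z => I z ∨ J z) (fun x => W x ∨ W' x) (k + l) a d := by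
  obtain ⟨p, hp, hk, hs⟩ := h
  obtain ⟨q, hq, hl, ht⟩ := h'
  obtain ⟨r, hr, hrl, hrs⟩ := exists_walk_append p q hp hq hbc (by
    intro x hx hx'
    rcases hs x hx with ⟨z, hz, hzx⟩ | h1 <;> rcases ht x hx' with ⟨z', hz', hzx'⟩ | h2
    · have := hI z z' hz hz'
      have := hf.eq_of_window (hzx.trans hzx'.symm) (by omega) (by omega)
      omega
    · exact h2.2 z hzx
    · exact h1.2 z' hzx'
    · exact hW x h1.1 h2.1)
  refine ⟨r, hr, by rw [hrl]; push_cast; omega, ?_⟩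
  intro x hx
  rcases hrs x hx with h | h
  · rcases hs x h with ⟨z, hz, hzx⟩ | h
    · exact Or.inl ⟨z, Or.inl hz, hzx⟩
    · exact Or.inr ⟨Or.inl h.1, h.2⟩
  · rcases ht x h with ⟨z, hz, hzx⟩ | h
    · exact Or.inl ⟨z, Or.inr hz, hzx⟩
    · exact Or.inr ⟨Or.inr h.1, h.2⟩

theorem le_of_hasPath (hf : IsLongestParam G L f) {I : ℤ → Prop} {W : V → Prop} {k : ℤ}
    {a b : V} (h : HasPath G f I W k a b) (hab : G.Adj b a) : k ≤ L := by
  by_contra hk'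
  obtain ⟨p, hp, hk, -⟩ := h
  have hL := hf.three_le
  have hc : (SimpleGraph.Walk.cons hab p).IsCycle := by
    rw [SimpleGraph.Walk.cons_isCycle_iff]
    refine ⟨hp, fun hmem => ?_⟩
    have := hp.length_eq_one_of_mem_edges (Sym2.eq_swap ▸ hmem)
    omega
  have := hf.le _ _ hc
  simp only [SimpleGraph.Walk.length_cons] at this
  push_cast at this
  omega

/-- An off-cycle path cannot bridge fewer vertices of a longest cycle than it has. -/
theorem not_bypass (hf : IsLongestParam G L f) {W : V → Prop} {k d i : ℤ} {h h' : V}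
    (hp : HasPath G f (fun _ => False) W k h h') (hd : 1 ≤ d) (hdk : d ≤ k) (hdL : d ≤ L)
    (h1 : G.Adj (f i) h) (h2 : G.Adj h' (f (i + d))) : False := by
  have h1' : G.Adj (f (i + L)) h := by rwa [hf.per]
  have A := hf.hasPath_arc (i := i + d) (j := i + L) (by omega) (by omega)
  have := hf.le_of_hasPath (hf.hasPath_append A h1' hp (by simp) (by simp)) h2
  omega

/-- Two crossing bridges, the second one being an edge. -/
theorem not_cross_edge (hf : IsLongestParam G L f) {W : V → Prop} {k s t i j : ℤ} {h h' : V}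
    (hp : HasPath G f (fun _ => False) W k h h') (hs : 1 ≤ s) (ht : 1 ≤ t) (hst : s + t < k + 2)
    (hi : i + s ≤ j) (hj : j + t ≤ i + L)
    (h1 : G.Adj (f i) h) (h2 : G.Adj (f j) h') : ¬ G.Adj (f (i + s)) (f (j + t)) := by
  intro h3
  have h1' : G.Adj h (f (i + L)) := by rw [hf.per]; exact h1.symm
  have A := hf.hasPath_arc (i := i + s) (j := j) (by omega) (by omega)
  have B := (hf.hasPath_arc (i := j + t) (j := i + L) (by omega) (by omega)).symm
  have AH := hf.hasPath_append A h2 hp.symm (by simp) (by simp)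
  have := hf.le_of_hasPath
    (hf.hasPath_append AH h1' B (by intro z z' hz hz'; simp only [or_false] at hz; omega) (by simp))
    h3.symm
  omega

/-- Two crossing bridges, the second one through a vertex off the cycle. -/
theorem not_cross_vertex (hf : IsLongestParam G L f) {W : V → Prop} {k s t i j : ℤ} {h h' r : V}
    (hp : HasPath G f (fun _ => False) W k h h') (hr : Off f r) (hrW : ¬ W r)
    (hs : 1 ≤ s) (ht : 1 ≤ t) (hst : s + t < k + 3)
    (hi : i + s ≤ j) (hj : j + t ≤ i + L)
    (h1 : G.Adj (f i) h) (h2 : G.Adj (f j) h') (h3 : G.Adj (f (i + s)) r)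
    (h4 : G.Adj (f (j + t)) r) : False := by
  have h1' : G.Adj h (f (i + L)) := by rw [hf.per]; exact h1.symm
  have A := hf.hasPath_arc (i := i + s) (j := j) (by omega) (by omega)
  have B := (hf.hasPath_arc (i := j + t) (j := i + L) (by omega) (by omega)).symm
  have AH := hf.hasPath_append A h2 hp.symm (by simp) (by simp)
  have AHB := hf.hasPath_append AH h1' B
    (by intro z z' hz hz'; simp only [or_false] at hz; omega) (by simp)
  have := hf.le_of_hasPath
    (hf.hasPath_append AHB h4 (hasPath_single hr) (by simp) (by
      intro x hx hxr
      subst hxr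
      simp only [false_or, or_false] at hx
      exact hrW hx))
    h3.symm
  omega

/-- The two ends of an off-cycle bridge between `f i` and `f j` leave no room for the chords
`f (i + 1) f z'` and `f (j + 1) f z` with `z < z'` close together. -/
theorem not_hop (hf : IsLongestParam G L f) {W : V → Prop} {k i j z z' : ℤ} {h h' : V}
    (hp : HasPath G f (fun _ => False) W k h h') (hz : i + 1 ≤ z) (hzz : z < z')
    (hz' : z' ≤ j) (hj : j + 1 ≤ i + L) (hk : z' - z ≤ k)
    (h1 : G.Adj (f i) h) (h2 : G.Adj (f j) h')
    (h3 : G.Adj (f (i + 1)) (f z')) (h4 : G.Adj (f (j + 1)) (f z)) : False := by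
  have h1' : G.Adj (f (i + L)) h := by rwa [hf.per]
  have A := hf.hasPath_arc (i := i + 1) (j := z) (by omega) (by omega)
  have B := hf.hasPath_arc (i := j + 1) (j := i + L) (by omega) (by omega)
  have C := (hf.hasPath_arc (i := z') (j := j) (by omega) (by omega)).symm
  have AB := hf.hasPath_append A h4.symm B (by intro y y' hy hy'; omega) (by simp)
  have ABH := hf.hasPath_append AB h1' hp (by simp) (by simp)
  have := hf.le_of_hasPath (hf.hasPath_append ABH h2.symm C
    (by intro y y' hy hy'; simp only [or_false] at hy; omega) (by simp)) h3.symm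
  omega

theorem hasPath_pair (hf : IsLongestParam G L f) {x y : V} (hx : Off f x) (hy : Off f y)
    (hxy : G.Adj x y) :
    HasPath G f (fun _ => False) (fun z => z = x ∨ z = y) 2 x y :=
  (hf.hasPath_append (hasPath_single hx) hxy (hasPath_single hy) (by simp)
    (fun z hz hz' => hxy.ne (hz.symm.trans hz'))).mono (by simp) (by simp)

theorem hasPath_triple (hf : IsLongestParam G L f) {x y w : V} (hx : Off f x) (hy : Off f y)
    (hw : Off f w) (hxy : G.Adj x y) (hyw : G.Adj y w) (hxw : x ≠ w) :
    HasPath G f (fun _ => False) (fun z => (z = x ∨ z = y) ∨ z = w) 3 x w :=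
  (hf.hasPath_append (hf.hasPath_pair hx hy hxy) hyw (hasPath_single hw) (by simp) (by
    rintro z (rfl | rfl) hz'
    · exact hxw hz'
    · exact hyw.ne hz')).mono (by simp) (by simp)

end IsLongestParam

theorem card_add_three_le {α : Type*} {A B C T : Finset α} (hA : A ⊆ T) (hB : B ⊆ T) (hC : C ⊆ T)
    (hAB : ∀ x ∈ A, x ∉ B) (hAC : ∀ x ∈ A, x ∉ C) (hBC : ∀ x ∈ B, x ∉ C) :
    A.card + B.card + C.card ≤ T.card := by
  rw [← Finset.card_union_of_disjoint (Finset.disjoint_left.2 hAB),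
    ← Finset.card_union_of_disjoint]
  · exact Finset.card_le_card (Finset.union_subset (Finset.union_subset hA hB) hC)
  · rw [Finset.disjoint_left]
    intro x hx
    rcases Finset.mem_union.1 hx with h | h
    · exact hAC x h
    · exact hBC x h

theorem card_add_three_le_of_shift {X Y Z T : Finset ℤ} (s t : ℤ) (hX : ∀ x ∈ X, x ∈ T)
    (hY : ∀ y ∈ Y, y + s ∈ T) (hZ : ∀ z ∈ Z, z + t ∈ T) (hXY : ∀ y ∈ Y, y + s ∉ X)
    (hXZ : ∀ z ∈ Z, z + t ∉ X) (hYZ : ∀ z ∈ Z, z + t - s ∉ Y) :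
    X.card + Y.card + Z.card ≤ T.card := by
  have hinj (c : ℤ) : Function.Injective fun x : ℤ => x + c := fun a b h => by simpa using h
  rw [← Finset.card_image_of_injective Y (hinj s), ← Finset.card_image_of_injective Z (hinj t)]
  apply card_add_three_le
  · exact hX
  · exact Finset.image_subset_iff.2 hY
  · exact Finset.image_subset_iff.2 hZ
  · intro x hx hx'
    obtain ⟨y, hy, rfl⟩ := Finset.mem_image.1 hx'
    exact hXY y hy hx
  · intro x hx hx'
    obtain ⟨y, hy, rfl⟩ := Finset.mem_image.1 hx'
    exact hXZ y hy hx
  · intro x hx hx'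
    obtain ⟨y, hy, rfl⟩ := Finset.mem_image.1 hx
    obtain ⟨z, hz, hzy⟩ := Finset.mem_image.1 hx'
    apply hYZ z hz
    have hzy' : z + t = y + s := hzy
    rwa [show z + t - s = y by omega]

/-- the indices in a period starting at `α` at which `f` takes a neighbor of `x` -/
def nbrIdx (G : SimpleGraph V) (L : ℤ) (f : ℤ → V) (α : ℤ) (x : V) : Finset ℤ :=
  (Finset.Ico α (α + L)).filter fun z => G.Adj x (f z)

/-- the vertices off `f` -/
def offVerts [Fintype V] (f : ℤ → V) : Finset V := Finset.univ.filter (Off f)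

/-- the neighbors of `x` off `f` -/
def offNbrs [Fintype V] (G : SimpleGraph V) (f : ℤ → V) (x : V) : Finset V :=
  Finset.univ.filter fun y => Off f y ∧ G.Adj x y

theorem mem_nbrIdx {G : SimpleGraph V} {L : ℤ} {f : ℤ → V} {α z : ℤ} {x : V} :
    z ∈ nbrIdx G L f α x ↔ (α ≤ z ∧ z < α + L) ∧ G.Adj x (f z) := by
  simp [nbrIdx]

theorem mem_offVerts [Fintype V] {f : ℤ → V} {x : V} : x ∈ offVerts f ↔ Off f x := by
  simp [offVerts]

theorem mem_offNbrs [Fintype V] {G : SimpleGraph V} {f : ℤ → V} {x y : V} :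
    y ∈ offNbrs G f x ↔ Off f y ∧ G.Adj x y := by
  simp [offNbrs]

namespace IsLongestParam

variable {G : SimpleGraph V} {L : ℤ} {f : ℤ → V}

theorem card_filter [Fintype V] (hf : IsLongestParam G L f) (α : ℤ) (Q : V → Prop) :
    (Finset.univ.filter Q).card = ((Finset.Ico α (α + L)).filter fun z => Q (f z)).card +
      (Finset.univ.filter fun y => Off f y ∧ Q y).card := by
  have hinj : Set.InjOn f ((Finset.Ico α (α + L)).filter fun z => Q (f z)) := by
    intro i hi j hj hij
    simp only [Finset.coe_filter, Finset.mem_Ico, Set.mem_ofPred_eq] at hi hj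
    exact hf.eq_of_window hij (by omega) (by omega)
  rw [← Finset.card_image_of_injOn hinj, ← Finset.card_union_of_disjoint]
  · congr 1
    ext x
    simp only [Finset.mem_filter, Finset.mem_univ, true_and, Finset.mem_union, Finset.mem_image,
      Finset.mem_Ico]
    constructor
    · intro hx
      by_cases ho : Off f x
      · exact Or.inr ⟨ho, hx⟩
      · simp only [Off, not_forall, not_not] at ho
        obtain ⟨i, hi⟩ := ho
        obtain ⟨j, h1, h2, h3⟩ := hf.window α i
        refine Or.inl ⟨j, ⟨⟨h1, h2⟩, ?_⟩, h3.trans hi⟩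
        rwa [h3, hi]
    · rintro (⟨j, ⟨-, h⟩, rfl⟩ | h)
      · exact h
      · exact h.2
  · rw [Finset.disjoint_left]
    intro x hx hx'
    obtain ⟨j, -, rfl⟩ := Finset.mem_image.1 hx
    exact (Finset.mem_filter.1 hx').2.1 j rfl

theorem deg_eq [Fintype V] (hf : IsLongestParam G L f) (α : ℤ) (x : V) :
    deg G x = (nbrIdx G L f α x).card + (offNbrs G f x).card := by
  rw [nbrIdx, offNbrs, ← hf.card_filter α (G.Adj x), deg, ← Set.ncard_coe_finset]
  congr 1
  ext y
  simp

theorem card_eq [Fintype V] (hf : IsLongestParam G L f) :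
    (Fintype.card V : ℤ) = L + (offVerts f).card := by
  have := hf.card_filter 0 (fun _ => True)
  have hL := hf.three_le
  simp only [Finset.filter_true, and_true, Finset.card_univ, Int.card_Ico] at this
  rw [this, offVerts]
  push_cast
  rw [Int.toNat_of_nonneg (by omega)]
  ring

end IsLongestParam

/-- The degree sum of any three distinct independent vertices is at least the order. -/
def DegSumGe [Fintype V] (G : SimpleGraph V) : Prop :=
  ∀ x y z, x ≠ y → x ≠ z → y ≠ z → ¬ G.Adj x y → ¬ G.Adj x z → ¬ G.Adj y z →
    Fintype.card V ≤ deg G x + deg G y + deg G z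

theorem degSumGe_of_le_sigma3 [Fintype V] {G : SimpleGraph V} (h : Fintype.card V ≤ sigma3 G) :
    DegSumGe G := by
  intro x y z hxy hxz hyz h1 h2 h3
  have hs : IsIndepTriple G {x, y, z} := by
    refine ⟨Finset.card_eq_three.2 ⟨x, y, z, hxy, hxz, hyz, rfl⟩, ?_⟩
    simp only [Finset.mem_insert, Finset.mem_singleton]
    rintro a (rfl | rfl | rfl) b (rfl | rfl | rfl) hab <;> simp_all [G.adj_comm]
  refine h.trans ?_
  rw [sigma3, if_pos ⟨_, hs⟩]
  apply Nat.sInf_le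
  refine ⟨_, hs, ?_⟩
  rw [Finset.sum_insert (by simp [hxy, hxz]), Finset.sum_insert (by simp [hyz]),
    Finset.sum_singleton, add_assoc]

/-- `u` is off the longest cycle `f` and adjacent to both cycle neighbors of `f 0`. -/
structure IsSpecial (G : SimpleGraph V) (L : ℤ) (f : ℤ → V) (u : V) : Prop where
  isLongest : IsLongestParam G L f
  off : Off f u
  adj_one : G.Adj u (f 1)
  adj_neg_one : G.Adj u (f (-1))

/-- the cycle `f` with the vertex `f 0` replaced by `u` -/
def swapZero (L : ℤ) (f : ℤ → V) (u : V) (i : ℤ) : V := if L ∣ i then u else f i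

namespace IsSpecial

variable {G : SimpleGraph V} {L : ℤ} {f : ℤ → V} {u : V}

theorem reflect (h : IsSpecial G L f u) : IsSpecial G L (fun i => f (-i)) u where
  isLongest := h.isLongest.reflect
  off z := h.off (-z)
  adj_one := h.adj_neg_one
  adj_neg_one := by simpa using h.adj_one

theorem adj_pred (h : IsSpecial G L f u) : G.Adj u (f (L - 1)) := by
  have := h.adj_neg_one
  rwa [← h.isLongest.per (-1), show -1 + L = L - 1 by ring] at this

theorem swap_of_lt {L i : ℤ} {f : ℤ → V} {u : V} (h1 : 0 < i) (h2 : i < L) :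
    swapZero L f u i = f i := by
  rw [swapZero, if_neg]
  intro h
  have := Int.le_of_dvd h1 h
  omega

theorem swap_zero : swapZero L f u 0 = u := by simp [swapZero]

theorem swap_period : swapZero L f u L = u := by simp [swapZero]

theorem swap_eq (h : IsSpecial G L f u) {i : ℤ} (hi : f i ≠ f 0) : swapZero L f u i = f i := by
  rw [swapZero, if_neg]
  rintro ⟨c, rfl⟩
  apply hi
  have := h.isLongest.per_mul 0 c
  rwa [zero_add, mul_comm] at this

theorem off_swap (h : IsSpecial G L f u) : Off (swapZero L f u) (f 0) := by
  intro z hz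
  unfold swapZero at hz
  split_ifs at hz with hd
  · exact h.off 0 hz.symm
  · have := h.isLongest.inj _ _ hz
    simp only [sub_zero] at this
    exact hd this

theorem off_swap_iff (h : IsSpecial G L f u) {x : V} :
    Off (swapZero L f u) x ↔ x = f 0 ∨ (x ≠ u ∧ Off f x) := by
  constructor
  · intro hx
    by_cases h0 : x = f 0
    · exact Or.inl h0
    refine Or.inr ⟨fun hu => hx 0 (by simp [swapZero, hu]), fun z hz => hx z ?_⟩
    rw [h.swap_eq (by rw [hz]; exact h0), hz]
  · rintro (rfl | ⟨hxu, hx⟩)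
    · exact h.off_swap
    · intro z hz
      unfold swapZero at hz
      split_ifs at hz
      · exact hxu hz.symm
      · exact hx z hz

theorem swap (h : IsSpecial G L f u) : IsSpecial G L (swapZero L f u) (f 0) := by
  have hf := h.isLongest
  have hL := hf.three_le
  refine ⟨⟨hL, ?_, ?_, ?_, hf.le⟩, h.off_swap, ?_, ?_⟩
  · intro i
    by_cases h1 : L ∣ i
    · obtain ⟨c, rfl⟩ := h1
      have h2 : ¬ L ∣ L * c + 1 := by
        intro hd
        have := (Int.dvd_add_right (Dvd.intro c rfl)).1 hd
        have := Int.le_of_dvd (by omega) this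
        omega
      rw [swapZero, swapZero, if_pos (Dvd.intro c rfl), if_neg h2,
        show L * c + 1 = 1 + c * L by ring, hf.per_mul]
      exact h.adj_one
    · by_cases h2 : L ∣ i + 1
      · rw [swapZero, swapZero, if_neg h1, if_pos h2]
        obtain ⟨c, hc⟩ := h2
        rw [show i = -1 + c * L by linarith, hf.per_mul]
        exact h.adj_neg_one.symm
      · rw [swapZero, swapZero, if_neg h1, if_neg h2]
        exact hf.adj i
  · intro i
    unfold swapZero
    simp [hf.per]
  · intro i j hij
    unfold swapZero at hij
    split_ifs at hij with h1 h2 h2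
    · exact dvd_sub h1 h2
    · exact (h.off _ hij.symm).elim
    · exact (h.off _ hij).elim
    · exact hf.inj _ _ hij
  · rw [swap_of_lt (by omega) (by omega)]
    simpa using hf.adj 0
  · rw [h.swap_eq]
    · have := hf.adj (-1)
      rw [show (-1 : ℤ) + 1 = 0 by ring] at this
      exact this.symm
    · intro h0
      have := hf.eq_of_window h0 (by omega) (by omega)
      omega

end IsSpecial

namespace IsSpecial

variable {G : SimpleGraph V} {L : ℤ} {f : ℤ → V} {u : V}

theorem four_le (h : IsSpecial G L f u) : 4 ≤ L := by
  have h3 := h.isLongest.three_le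
  by_contra h4
  have hL : L = 3 := by omega
  subst hL
  exact h.isLongest.not_bypass (hasPath_single h.off) (d := 1) (i := 1) le_rfl le_rfl (by omega)
    h.adj_one.symm h.adj_pred

theorem not_adj_zero (h : IsSpecial G L f u) : ¬ G.Adj u (f 0) := fun h0 =>
  h.isLongest.not_bypass (hasPath_single h.off) (d := 1) (i := 0) le_rfl le_rfl
    (by have := h.four_le; omega) h0.symm (by simpa using h.adj_one)

theorem zero_adj_one (h : IsSpecial G L f u) : G.Adj (f 0) (f 1) := by
  simpa using h.isLongest.adj 0

/-- Successors of neighbors of `u` are not neighbors of `f 0`. -/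
theorem not_adj_zero_succ (h : IsSpecial G L f u) {z : ℤ} (hz1 : 1 ≤ z) (hz2 : z ≤ L - 2)
    (hu : G.Adj u (f z)) : ¬ G.Adj (f 0) (f (z + 1)) := by
  have := h.isLongest.not_cross_edge (hasPath_single h.off) (i := -1) (j := z) (s := 1) (t := 1)
    le_rfl le_rfl (by omega) (by omega) (by omega) h.adj_neg_one.symm hu.symm
  simpa using this

/-- Predecessors of neighbors of `u` are not neighbors of `f 0`. -/
theorem not_adj_zero_pred (h : IsSpecial G L f u) {z : ℤ} (hz1 : 2 ≤ z) (hz2 : z ≤ L - 1)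
    (hu : G.Adj u (f z)) : ¬ G.Adj (f 0) (f (z - 1)) := by
  have hL := h.four_le
  intro h0
  have := h.swap.not_adj_zero_succ (z := z - 1) (by omega) (by omega)
  rw [swap_of_lt (by omega) (by omega), swap_zero, show z - 1 + 1 = z by ring,
    swap_of_lt (by omega) (by omega)] at this
  exact this h0 hu

theorem not_adj_succ (h : IsSpecial G L f u) {z : ℤ} (hu : G.Adj u (f z)) :
    ¬ G.Adj u (f (z + 1)) := fun h' =>
  h.isLongest.not_bypass (hasPath_single h.off) (d := 1) (i := z) le_rfl le_rfl
    (by have := h.four_le; omega) hu.symm h'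

theorem zero_not_adj_succ (h : IsSpecial G L f u) {z : ℤ} (hz1 : 1 ≤ z) (hz2 : z ≤ L - 2)
    (h0 : G.Adj (f 0) (f z)) : ¬ G.Adj (f 0) (f (z + 1)) := by
  have := h.swap.not_adj_succ (z := z)
  rw [swap_of_lt (by omega) (by omega), swap_of_lt (by omega) (by omega)] at this
  exact this h0

/-- A special vertex has no neighbors off the cycle. -/
theorem not_adj_off [Fintype V] (hσ : DegSumGe G) (h : IsSpecial G L f u) {w : V} (hw : Off f w) :
    ¬ G.Adj u w := by
  intro huw
  have hf := h.isLongest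
  have hs := h.swap
  have hL := h.four_le
  have hne : u ≠ w := huw.ne
  have hP := hf.hasPath_pair h.off hw huw
  have hu1 := h.adj_one
  have hu2 := h.adj_neg_one
  have e2 : swapZero L f u 2 = f 2 := swap_of_lt (by omega) (by omega)
  have e1 : swapZero L f u 1 = f 1 := swap_of_lt (by omega) (by omega)
  have hw1 : ¬ G.Adj w (f 1) := fun hh =>
    hf.not_bypass hP (d := 2) (i := -1) (by omega) (by omega) (by omega) hu2.symm (by simpa using hh)
  have hwL : ¬ G.Adj w (f (L - 1)) := fun hh => by
    rw [show L - 1 = -1 + L by ring, hf.per] at hh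
    exact hf.not_bypass hP.symm (d := 2) (i := -1) (by omega) (by omega) (by omega) hh.symm
      (by simpa using hu1)
  have hw0 : ¬ G.Adj w (f 0) := fun hh =>
    hf.not_bypass hP (d := 1) (i := -1) (by omega) (by omega) (by omega) hu2.symm (by simpa using hh)
  have hw2 : ¬ G.Adj w (f 2) := fun hh =>
    hf.not_bypass hP (d := 1) (i := 1) (by omega) (by omega) (by omega) hu1.symm (by simpa using hh)
  have h02 : ¬ G.Adj (f 0) (f 2) := by
    have := h.zero_not_adj_succ (z := 1) (by omega) (by omega) h.zero_adj_one
    simpa using this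
  have hsum := hσ w (f 0) (f 2) (Ne.symm (hw 0)) (Ne.symm (hw 2))
    (fun hh => by have := hf.eq_of_window hh (by omega) (by omega); omega) hw0 hw2 h02
  rw [hf.deg_eq 0 w, hf.deg_eq 0 (f 0), hf.deg_eq 0 (f 2)] at hsum
  have hcard := hf.card_eq
  -- neighbors off the cycle
  have hoff : (offNbrs G f w).card + (offNbrs G f (f 0)).card + (offNbrs G f (f 2)).card ≤
      ((offVerts f).erase w).card := by
    have hne_u : ∀ {r}, G.Adj (f 0) r → r ≠ u := by
      rintro r hr rfl
      exact h.not_adj_zero hr.symm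
    apply card_add_three_le
    · intro r hr
      rw [mem_offNbrs] at hr
      exact Finset.mem_erase.2 ⟨hr.2.ne', mem_offVerts.2 hr.1⟩
    · intro r hr
      rw [mem_offNbrs] at hr
      refine Finset.mem_erase.2 ⟨?_, mem_offVerts.2 hr.1⟩
      rintro rfl
      exact hw0 hr.2.symm
    · intro r hr
      rw [mem_offNbrs] at hr
      refine Finset.mem_erase.2 ⟨?_, mem_offVerts.2 hr.1⟩
      rintro rfl
      exact hw2 hr.2.symm
    · intro r hr hr'
      rw [mem_offNbrs] at hr hr'
      exact hf.not_bypass (hf.hasPath_triple h.off hw hr.1 huw hr.2 (hne_u hr'.2).symm) (d := 1)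
        (i := -1) (by omega) (by omega) (by omega) hu2.symm (by simpa using hr'.2.symm)
    · intro r hr hr'
      rw [mem_offNbrs] at hr hr'
      by_cases hru : r = u
      · subst hru
        exact h.not_adj_succ hu1 (by simpa using hr'.2.symm)
      exact hf.not_bypass (hf.hasPath_triple h.off hw hr.1 huw hr.2 (Ne.symm hru)) (d := 1)
        (i := 1) (by omega) (by omega) (by omega) hu1.symm (by simpa using hr'.2.symm)
    · intro r hr hr'
      rw [mem_offNbrs] at hr hr'
      have hro : Off (swapZero L f u) r := h.off_swap_iff.2 (Or.inr ⟨hne_u hr.2, hr.1⟩)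
      refine hs.isLongest.not_bypass (hs.isLongest.hasPath_pair hs.off hro hr.2) (d := 1)
        (i := 1) (by omega) (by omega) (by omega) hs.adj_one.symm ?_
      rw [show (1 : ℤ) + 1 = 2 by norm_num, e2]
      exact hr'.2.symm
  rw [Finset.card_erase_of_mem (mem_offVerts.2 hw)] at hoff
  have hpos : 0 < (offVerts f).card := Finset.card_pos.2 ⟨w, mem_offVerts.2 hw⟩
  -- neighbors on the cycle
  have hcyc : ((nbrIdx G L f 0 (f 0)).erase 1).card + ((nbrIdx G L f 0 (f 2)).erase 1).card +
      (nbrIdx G L f 0 w).card ≤ (Finset.Icc 2 (L - 1)).card := by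
    have hD : ∀ z, z ∈ (nbrIdx G L f 0 (f 0)).erase 1 → 3 ≤ z ∧ z ≤ L - 1 ∧ G.Adj (f 0) (f z) := by
      intro z hz
      rw [Finset.mem_erase, mem_nbrIdx] at hz
      have : z ≠ 0 := by rintro rfl; exact hz.2.2.ne rfl
      have : z ≠ 2 := by rintro rfl; exact h02 hz.2.2
      exact ⟨by omega, by omega, hz.2.2⟩
    have hY : ∀ z, z ∈ (nbrIdx G L f 0 (f 2)).erase 1 → 3 ≤ z ∧ z ≤ L - 1 ∧ G.Adj (f 2) (f z) := by
      intro z hz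
      rw [Finset.mem_erase, mem_nbrIdx] at hz
      have : z ≠ 0 := by rintro rfl; exact h02 hz.2.2.symm
      have : z ≠ 2 := by rintro rfl; exact hz.2.2.ne rfl
      exact ⟨by omega, by omega, hz.2.2⟩
    have hE : ∀ z, z ∈ nbrIdx G L f 0 w → 3 ≤ z ∧ z ≤ L - 2 ∧ G.Adj w (f z) := by
      intro z hz
      rw [mem_nbrIdx] at hz
      have : z ≠ 0 := by rintro rfl; exact hw0 hz.2
      have : z ≠ 1 := by rintro rfl; exact hw1 hz.2
      have : z ≠ 2 := by rintro rfl; exact hw2 hz.2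
      have : z ≠ L - 1 := by rintro rfl; exact hwL hz.2
      exact ⟨by omega, by omega, hz.2⟩
    apply card_add_three_le_of_shift (-1) 1
    · intro z hz
      have := hD z hz
      simp only [Finset.mem_Icc]; omega
    · intro z hz
      have := hY z hz
      simp only [Finset.mem_Icc]; omega
    · intro z hz
      have := hE z hz
      simp only [Finset.mem_Icc]; omega
    · intro z hz hz'
      obtain ⟨h1, h2, h3⟩ := hY z hz
      obtain ⟨h4, h5, h6⟩ := hD _ hz'
      have := hs.isLongest.not_cross_edge (hasPath_single hs.off) (i := 1) (j := z + -1) (s := 1)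
        (t := 1) le_rfl le_rfl (by omega) (by omega) (by omega) hs.adj_one.symm
        (by rw [swap_of_lt (by omega) (by omega)]; exact h6.symm)
      rw [show (1 : ℤ) + 1 = 2 by norm_num, e2, show z + -1 + 1 = z by ring,
        swap_of_lt (by omega) (by omega)] at this
      exact this h3
    · intro z hz hz'
      obtain ⟨h1, h2, h3⟩ := hE z hz
      obtain ⟨h4, h5, h6⟩ := hD _ hz'
      have := hf.not_cross_edge hP (i := -1) (j := z) (s := 1)
        (t := 1) le_rfl le_rfl (by omega) (by omega) (by omega) hu2.symm h3.symm
      exact this (by simpa using h6)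
    · intro z hz hz'
      obtain ⟨h1, h2, h3⟩ := hE z hz
      obtain ⟨h4, h5, h6⟩ := hY _ hz'
      have := hf.not_cross_edge hP (i := 1) (j := z) (s := 1)
        (t := 2) le_rfl (by omega) (by omega) (by omega) (by omega) hu1.symm h3.symm
      rw [show z + 1 - -1 = z + 2 by ring] at h6
      exact this h6
  rw [Int.card_Icc] at hcyc
  have := Finset.pred_card_le_card_erase (s := nbrIdx G L f 0 (f 0)) (a := 1)
  have := Finset.pred_card_le_card_erase (s := nbrIdx G L f 0 (f 2)) (a := 1)
  omega

end IsSpecial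

namespace IsSpecial

variable {G : SimpleGraph V} {L : ℤ} {f : ℤ → V} {u : V}

theorem zero_not_adj_off [Fintype V] (hσ : DegSumGe G) (h : IsSpecial G L f u) {w : V}
    (hw : Off f w) : ¬ G.Adj (f 0) w := by
  intro h0
  by_cases hwu : w = u
  · subst hwu
    exact h.not_adj_zero h0.symm
  · exact h.swap.not_adj_off hσ (h.off_swap_iff.2 (Or.inr ⟨hwu, hw⟩)) h0

theorem not_chord_after (h : IsSpecial G L f u) {p z e : ℤ} {r : V} (hr : Off f r) (hru : r ≠ u)
    (hp : 1 ≤ p) (hpz : p + 1 ≤ z) (hze : z < e) (he : e ≤ L - 1) (hez : e ≤ z + 2)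
    (hup : G.Adj u (f p)) (h0z : G.Adj (f 0) (f z)) (hrp : G.Adj r (f (p + 1)))
    (hre : G.Adj r (f e)) : False := by
  have hf := h.isLongest
  have A := hf.hasPath_append (hasPath_single hr) hrp
    (hf.hasPath_arc (i := p + 1) (j := z) (by omega) (by omega)) (by simp) (by simp)
  have B := hf.hasPath_append A h0z.symm
    (hf.hasPath_arc (i := 0) (j := p) (by omega) (by omega))
    (by intro z z' hz hz'; simp only [false_or] at hz; omega) (by simp)
  have C := hf.hasPath_append B hup.symm (hasPath_single h.off) (by simp) (by
    rintro x hx rfl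
    simp only [or_false] at hx
    exact hru hx.symm)
  have D := hf.hasPath_append C h.adj_pred
    (hf.hasPath_arc (i := e) (j := L - 1) (by omega) (by omega)).symm
    (by intro z z' hz hz'; simp only [false_or, or_false] at hz; omega) (by simp)
  have := hf.le_of_hasPath D hre.symm
  omega

theorem not_chord_before (h : IsSpecial G L f u) {p z e : ℤ} {r : V} (hr : Off f r) (hru : r ≠ u)
    (he : 1 ≤ e) (hez : e < z) (hze : z ≤ e + 2) (hzp : z ≤ p) (hp : p ≤ L - 2)
    (hup : G.Adj u (f p)) (h0z : G.Adj (f 0) (f z)) (hrp : G.Adj r (f (p + 1)))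
    (hre : G.Adj r (f e)) : False := by
  have hf := h.isLongest
  have A := hf.hasPath_append (hasPath_single hr) hrp
    (hf.hasPath_arc (i := p + 1) (j := L - 1) (by omega) (by omega)) (by simp) (by simp)
  have B := hf.hasPath_append A h.adj_pred.symm (hasPath_single h.off) (by simp) (by
    rintro x hx rfl
    simp only [or_false] at hx
    exact hru hx.symm)
  have C := hf.hasPath_append B hup
    (hf.hasPath_arc (i := z) (j := p) (by omega) (by omega)).symm
    (by intro z z' hz hz'; simp only [false_or, or_false] at hz; omega) (by simp)
  have D := hf.hasPath_append C h0z.symm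
    (hf.hasPath_arc (i := 0) (j := e) (by omega) (by omega))
    (by intro z z' hz hz'; simp only [false_or, or_false] at hz; omega) (by simp)
  have := hf.le_of_hasPath D hre.symm
  omega

/-- Successors of neighbors of a special vertex have no neighbors off the cycle. -/
theorem off_not_adj_succ [Fintype V] (hσ : DegSumGe G) (h : IsSpecial G L f u) {p : ℤ} {r : V}
    (hr : Off f r) (hp1 : 1 ≤ p) (hp2 : p ≤ L - 2) (hup : G.Adj u (f p)) :
    ¬ G.Adj r (f (p + 1)) := by
  intro hrp
  have hf := h.isLongest
  have hL := h.four_le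
  have hru : r ≠ u := by
    rintro rfl
    exact h.not_adj_succ hup hrp
  have hr0 : ¬ G.Adj r (f 0) := fun hh => h.zero_not_adj_off hσ hr hh.symm
  have hsum := hσ u (f 0) r (Ne.symm (h.off 0)) hru.symm (hr 0) h.not_adj_zero
    (h.not_adj_off hσ hr) (h.zero_not_adj_off hσ hr)
  have hcons : ∀ {z}, G.Adj r (f z) → ¬ G.Adj r (f (z + 1)) := fun {z} hz hz' =>
    hf.not_bypass (hasPath_single hr) (d := 1) (i := z) le_rfl le_rfl (by omega) hz.symm hz'
  rw [hf.deg_eq 0 u, hf.deg_eq 0 (f 0), hf.deg_eq 0 r] at hsum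
  have hou : offNbrs G f u = ∅ := Finset.eq_empty_of_forall_notMem fun x hx => by
    rw [mem_offNbrs] at hx
    exact h.not_adj_off hσ hx.1 hx.2
  have ho0 : offNbrs G f (f 0) = ∅ := Finset.eq_empty_of_forall_notMem fun x hx => by
    rw [mem_offNbrs] at hx
    exact h.zero_not_adj_off hσ hx.1 hx.2
  have hor : (offNbrs G f r).card ≤ (((offVerts f).erase r).erase u).card := by
    apply Finset.card_le_card
    intro x hx
    rw [mem_offNbrs] at hx
    refine Finset.mem_erase.2 ⟨?_, Finset.mem_erase.2 ⟨hx.2.ne', mem_offVerts.2 hx.1⟩⟩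
    rintro rfl
    exact h.not_adj_off hσ hr hx.2.symm
  rw [Finset.card_erase_of_mem (Finset.mem_erase.2 ⟨hru.symm, mem_offVerts.2 h.off⟩),
    Finset.card_erase_of_mem (mem_offVerts.2 hr)] at hor
  have hcard := hf.card_eq
  have h2 : 1 < (offVerts f).card := Finset.one_lt_card.2
    ⟨u, mem_offVerts.2 h.off, r, mem_offVerts.2 hr, hru.symm⟩
  set F := nbrIdx G L f 0 u with hFdef
  set D := nbrIdx G L f 0 (f 0) with hDdef
  set E := nbrIdx G L f 0 r with hEdef
  have hF : ∀ z, z ∈ F → 1 ≤ z ∧ z ≤ L - 1 ∧ G.Adj u (f z) := by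
    intro z hz
    rw [hFdef, mem_nbrIdx] at hz
    have : z ≠ 0 := by rintro rfl; exact h.not_adj_zero hz.2
    exact ⟨by omega, by omega, hz.2⟩
  have hD : ∀ z, z ∈ D → 1 ≤ z ∧ z ≤ L - 1 ∧ G.Adj (f 0) (f z) := by
    intro z hz
    rw [hDdef, mem_nbrIdx] at hz
    have : z ≠ 0 := by rintro rfl; exact hz.2.ne rfl
    exact ⟨by omega, by omega, hz.2⟩
  have hE : ∀ z, z ∈ E → 1 ≤ z ∧ z ≤ L - 1 ∧ G.Adj r (f z) := by
    intro z hz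
    rw [hEdef, mem_nbrIdx] at hz
    have : z ≠ 0 := by rintro rfl; exact hr0 hz.2
    exact ⟨by omega, by omega, hz.2⟩
  have hup1 : ¬ G.Adj u (f (p + 1)) := h.not_adj_succ hup
  have hrp0 : ¬ G.Adj r (f p) := fun hh => hcons hh hrp
  have arc1 : ((F.filter (¬ · ≤ p)) ∪ (E.filter (¬ · ≤ p))).card +
      ((F.filter (¬ · ≤ p)) ∩ (E.filter (¬ · ≤ p))).card + (D.filter (¬ · ≤ p)).card ≤
      (Finset.Icc (p + 1) L).card := by
    apply card_add_three_le_of_shift (-1) 1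
    · intro z hz
      simp only [Finset.mem_union, Finset.mem_filter, Finset.mem_Icc] at hz ⊢
      rcases hz with hz | hz
      · have := hF z hz.1; omega
      · have := hE z hz.1; omega
    · intro z hz
      simp only [Finset.mem_inter, Finset.mem_filter, Finset.mem_Icc] at hz ⊢
      have := hF z hz.1.1
      have : z ≠ p + 1 := by rintro rfl; exact hup1 this.2.2
      omega
    · intro z hz
      simp only [Finset.mem_filter, Finset.mem_Icc] at hz ⊢
      have := hD z hz.1
      omega
    · intro z hz hz'
      simp only [Finset.mem_inter, Finset.mem_union, Finset.mem_filter] at hz hz'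
      rcases hz' with hz' | hz'
      · exact h.not_adj_succ (hF _ hz'.1).2.2 (by simpa using (hF _ hz.1.1).2.2)
      · exact hcons (hE _ hz'.1).2.2 (by simpa using (hE _ hz.2.1).2.2)
    · intro z hz hz'
      simp only [Finset.mem_union, Finset.mem_filter] at hz hz'
      have hDz := hD z hz.1
      rcases hz' with hz' | hz'
      · have := hF _ hz'.1
        exact h.not_adj_zero_pred (by omega) (by omega) this.2.2 (by simpa using hDz.2.2)
      · have := hE _ hz'.1
        exact h.not_chord_after hr hru hp1 (by omega) (by omega) (by omega) (by omega) hup hDz.2.2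
          hrp this.2.2
    · intro z hz hz'
      simp only [Finset.mem_inter, Finset.mem_filter] at hz hz'
      have hDz := hD z hz.1
      have := hE _ hz'.2.1
      exact h.not_chord_after hr hru hp1 (by omega) (by omega) (by omega) (by omega) hup hDz.2.2
        hrp this.2.2
  have arc2 : ((F.filter (· ≤ p)) ∪ (E.filter (· ≤ p))).card +
      ((F.filter (· ≤ p)) ∩ (E.filter (· ≤ p))).card + (D.filter (· ≤ p)).card ≤
      (Finset.Icc 0 p).card := by
    apply card_add_three_le_of_shift 1 (-1)
    · intro z hz
      simp only [Finset.mem_union, Finset.mem_filter, Finset.mem_Icc] at hz ⊢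
      rcases hz with hz | hz
      · have := hF z hz.1; omega
      · have := hE z hz.1; omega
    · intro z hz
      simp only [Finset.mem_inter, Finset.mem_filter, Finset.mem_Icc] at hz ⊢
      have := hE z hz.2.1
      have : z ≠ p := by rintro rfl; exact hrp0 this.2.2
      omega
    · intro z hz
      simp only [Finset.mem_filter, Finset.mem_Icc] at hz ⊢
      have := hD z hz.1
      omega
    · intro z hz hz'
      simp only [Finset.mem_inter, Finset.mem_union, Finset.mem_filter] at hz hz'
      rcases hz' with hz' | hz'
      · exact h.not_adj_succ (hF _ hz.1.1).2.2 (hF _ hz'.1).2.2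
      · exact hcons (hE _ hz.2.1).2.2 (hE _ hz'.1).2.2
    · intro z hz hz'
      simp only [Finset.mem_union, Finset.mem_filter] at hz hz'
      have hDz := hD z hz.1
      rcases hz' with hz' | hz'
      · have := hF _ hz'.1
        exact h.not_adj_zero_succ (by omega) (by omega) this.2.2 (by simpa using hDz.2.2)
      · have := hE _ hz'.1
        exact h.not_chord_before hr hru (by omega) (by omega) (by omega) (by omega) hp2 hup
          hDz.2.2 hrp this.2.2
    · intro z hz hz'
      simp only [Finset.mem_inter, Finset.mem_filter] at hz hz'
      have hDz := hD z hz.1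
      have := hE _ hz'.2.1
      exact h.not_chord_before hr hru (by omega) (by omega) (by omega) (by omega) hp2 hup
        hDz.2.2 hrp this.2.2
  rw [Finset.card_union_add_card_inter, Int.card_Icc] at arc1 arc2
  have hFs := F.card_filter_add_card_filter_not (· ≤ p)
  have hDs := D.card_filter_add_card_filter_not (· ≤ p)
  have hEs := E.card_filter_add_card_filter_not (· ≤ p)
  rw [hou, ho0, Finset.card_empty] at hsum
  omega

theorem off_not_adj_pred [Fintype V] (hσ : DegSumGe G) (h : IsSpecial G L f u) {p : ℤ} {r : V}
    (hr : Off f r) (hp1 : 2 ≤ p) (hp2 : p ≤ L - 1) (hup : G.Adj u (f p)) :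
    ¬ G.Adj r (f (p - 1)) := by
  have := h.reflect.off_not_adj_succ hσ (p := L - p) (r := r) (fun z => hr _) (by omega)
    (by omega) (by
      have := h.isLongest.per' p
      rwa [show -(L - p) = p - L by ring, this])
  rwa [show -(L - p + 1) = p - 1 - L by ring, h.isLongest.per'] at this

/-- Successors of neighbors of `f 0` have no neighbors off the cycle. -/
theorem off_not_adj_zero_succ [Fintype V] (hσ : DegSumGe G) (h : IsSpecial G L f u) {p : ℤ}
    {r : V} (hr : Off f r) (hp1 : 1 ≤ p) (hp2 : p ≤ L - 2) (h0 : G.Adj (f 0) (f p)) :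
    ¬ G.Adj r (f (p + 1)) := by
  intro hrp
  by_cases hru : r = u
  · subst hru
    exact h.not_adj_zero_pred (by omega) (by omega) hrp (by simpa using h0)
  · have := h.swap.off_not_adj_succ hσ (h.off_swap_iff.2 (Or.inr ⟨hru, hr⟩)) hp1 hp2
      (by rwa [swap_of_lt (by omega) (by omega)])
    rw [swap_of_lt (by omega) (by omega)] at this
    exact this hrp

/-- Predecessors of neighbors of `f 0` have no neighbors off the cycle. -/
theorem off_not_adj_zero_pred [Fintype V] (hσ : DegSumGe G) (h : IsSpecial G L f u) {p : ℤ}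
    {r : V} (hr : Off f r) (hp1 : 2 ≤ p) (hp2 : p ≤ L - 1) (h0 : G.Adj (f 0) (f p)) :
    ¬ G.Adj r (f (p - 1)) := by
  have := h.reflect.off_not_adj_zero_succ hσ (p := L - p) (r := r) (fun z => hr _) (by omega)
    (by omega) (by
      have := h.isLongest.per' p
      rwa [show -(L - p) = p - L by ring, this])
  rwa [show -(L - p + 1) = p - 1 - L by ring, h.isLongest.per'] at this

end IsSpecial

/-- `a` and `b` are joined by a walk off `f`. -/
def OffConn (G : SimpleGraph V) (f : ℤ → V) (a b : V) : Prop :=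
  ∃ p : G.Walk a b, ∀ x ∈ p.support, Off f x

namespace OffConn

variable {G : SimpleGraph V} {f : ℤ → V} {a b c : V}

theorem refl (ha : Off f a) : OffConn G f a a := ⟨.nil, by simpa using ha⟩

theorem symm (h : OffConn G f a b) : OffConn G f b a := by
  obtain ⟨p, hp⟩ := h
  exact ⟨p.reverse, by simpa using hp⟩

theorem trans (h : OffConn G f a b) (h' : OffConn G f b c) : OffConn G f a c := by
  obtain ⟨p, hp⟩ := h
  obtain ⟨q, hq⟩ := h'
  refine ⟨p.append q, fun x hx => ?_⟩
  rcases (SimpleGraph.Walk.mem_support_append_iff _ _).1 hx with h | h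
  · exact hp x h
  · exact hq x h

theorem off_left (h : OffConn G f a b) : Off f a := by
  obtain ⟨p, hp⟩ := h
  exact hp a (by simp)

theorem off_right (h : OffConn G f a b) : Off f b := h.symm.off_left

theorem of_adj (ha : Off f a) (hb : Off f b) (hab : G.Adj a b) : OffConn G f a b :=
  ⟨hab.toWalk, by simp [ha, hb]⟩

theorem hasPath (h : OffConn G f a b) :
    ∃ k, HasPath G f (fun _ => False) (OffConn G f a) k a b := by
  obtain ⟨p, hp⟩ := h
  refine ⟨_, p.bypass, p.bypass_isPath, rfl, fun x hx => Or.inr ?_⟩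
  have hx' := p.support_bypass_subset_support hx
  exact ⟨⟨p.takeUntil x hx', fun y hy => hp y (p.support_takeUntil_subset_support hx' hy)⟩, hp x hx'⟩

end OffConn

theorem IsLongestParam.not_adj_offConn {G : SimpleGraph V} {L : ℤ} {f : ℤ → V}
    (hf : IsLongestParam G L f) {a b : V} {z : ℤ} (hab : OffConn G f a b) (ha : G.Adj (f z) a) :
    ¬ G.Adj (f (z + 1)) b := by
  obtain ⟨k, hk⟩ := hab.hasPath
  have := hk.pos
  have := hf.three_le
  exact fun hb => hf.not_bypass hk (d := 1) le_rfl (by omega) (by omega) ha hb.symm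

theorem OneTough.exists_adj [Fintype V] {G : SimpleGraph V} (hG : OneTough G) (s : V)
    {P : V → Prop} {x y : V} (hx : P x) (hy : ¬ P y) (hxs : x ≠ s) (hys : y ≠ s) :
    ∃ a b, P a ∧ ¬ P b ∧ a ≠ s ∧ b ≠ s ∧ G.Adj a b := by
  have hc := hG {s} (Set.singleton_nonempty s)
  rw [Set.ncard_singleton] at hc
  have hsub : Subsingleton (G.induce ({s}ᶜ : Set V)).ConnectedComponent :=
    Finite.card_le_one_iff_subsingleton.1 hc
  have hreach : (G.induce ({s}ᶜ : Set V)).Reachable ⟨x, hxs⟩ ⟨y, hys⟩ :=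
    SimpleGraph.ConnectedComponent.exact (Subsingleton.elim _ _)
  obtain ⟨p⟩ := hreach
  obtain ⟨d, -, h1, h2⟩ := p.exists_boundary_dart {z | P z} hx hy
  exact ⟨d.fst, d.snd, h1, h2, d.fst.2, d.snd.2, d.adj⟩

namespace IsSpecial

variable {G : SimpleGraph V} {L : ℤ} {f : ℤ → V} {u : V}

theorem eq_of_offConn [Fintype V] (hσ : DegSumGe G) (h : IsSpecial G L f u) {x : V}
    (hx : OffConn G f u x) : x = u := by
  obtain ⟨p, hp⟩ := hx
  cases p with
  | nil => rfl
  | cons hadj q => exact (h.not_adj_off hσ (hp _ (by simp)) hadj).elim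

/-- The position, on the arc avoiding `f (i + 1) ⋯ f j`, not used in the degree count. -/
theorem exists_free_index [Fintype V] (hσ : DegSumGe G) (h : IsSpecial G L f u) {a b : V} {i j : ℤ}
    (hab : OffConn G f a b) (hne : a ≠ b) (hi : 1 ≤ i) (hij : i < j) (hj : j ≤ L - 1)
    (hai : G.Adj (f i) a) (hbj : G.Adj (f j) b) :
    ∃ l, j + 1 ≤ l ∧ l ≤ i + L ∧ ¬ G.Adj (f (i + 1)) (f l) ∧ ¬ G.Adj (f (j + 1)) (f (l + 1)) := by
  have hf := h.isLongest
  have hL := h.four_le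
  obtain ⟨k, hk⟩ := hab.symm.hasPath
  have hk2 := hk.two_le hne.symm
  have haL : G.Adj (f (i + L)) a := by rwa [hf.per]
  have hx : f (i + 1) = f (i + L + 1) := by rw [← hf.per (i + 1)]; congr 1; ring
  have hL0 : f L = f 0 := by simpa using hf.per 0
  by_cases hjL : j = L - 1
  · refine ⟨L + 1, by omega, by omega, ?_, ?_⟩
    · have := hf.not_cross_edge hk (i := j) (j := i + L) (s := 2) (t := 1) (by omega) (by omega)
        (by omega) (by omega) (by omega) hbj haL
      rw [hx, G.adj_comm]
      rwa [show j + 2 = L + 1 by omega] at this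
    · have := h.zero_not_adj_succ (z := 1) le_rfl (by omega) h.zero_adj_one
      rw [hjL, show L - 1 + 1 = L by ring, hL0, show L + 1 + 1 = 2 + L by ring, hf.per]
      exact this
  · by_contra! hcon
    have hx0 : ¬ G.Adj (f (i + 1)) (f L) := by
      rw [hL0, G.adj_comm]
      intro hh
      exact h.off_not_adj_zero_pred hσ hab.off_left (by omega) (by omega) hh
        (by simpa using hai.symm)
    have hy0 : ¬ G.Adj (f (j + 1)) (f L) := by
      rw [hL0, G.adj_comm]
      intro hh
      exact h.off_not_adj_zero_pred hσ hab.off_right (by omega) (by omega) hh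
        (by simpa using hbj.symm)
    have h1 := hcon L (by omega) (by omega) hx0
    by_cases h2 : G.Adj (f (i + 1)) (f (L - 1))
    · rw [hx] at h2
      exact hf.not_hop hk (i := j) (j := i + L) (z := L - 1) (z' := L + 1) (by omega) (by omega)
        (by omega) (by omega) (by omega) hbj haL h1 h2
    · exact hy0 (by simpa using hcon (L - 1) (by omega) (by omega) h2)

theorem false_of_attachments [Fintype V] (hσ : DegSumGe G) (h : IsSpecial G L f u) {a b : V}
    {i j : ℤ} (hab : OffConn G f a b) (hne : a ≠ b) (hi : 1 ≤ i) (hij : i < j) (hj : j ≤ L - 1)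
    (hai : G.Adj (f i) a) (hbj : G.Adj (f j) b)
    (hb : ∀ z, j < z → z < i + L → ¬ G.Adj b (f z)) : False := by
  have hf := h.isLongest
  have hL := h.four_le
  obtain ⟨k, hk⟩ := hab.hasPath
  have hk2 := hk.two_le hne
  have haL : G.Adj (f (i + L)) a := by rwa [hf.per]
  have hx : f (i + 1) = f (i + L + 1) := by rw [← hf.per (i + 1)]; congr 1; ring
  have ha_off := hab.off_left
  have hb_off := hab.off_right
  have hbu : b ≠ u := by
    rintro rfl
    exact hne (h.eq_of_offConn hσ hab.symm)
  have hxr : ∀ {r}, OffConn G f a r → ¬ G.Adj (f (i + 1)) r := fun hr =>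
    hf.not_adj_offConn hr hai
  have hyr : ∀ {r}, OffConn G f a r → ¬ G.Adj (f (j + 1)) r := fun hr =>
    hf.not_adj_offConn (hab.symm.trans hr) hbj
  have hxy : ¬ G.Adj (f (i + 1)) (f (j + 1)) := hf.not_cross_edge hk le_rfl le_rfl (by omega)
    (by omega) (by omega) hai hbj
  have hsum := hσ b (f (i + 1)) (f (j + 1)) (Ne.symm (hb_off _)) (Ne.symm (hb_off _))
    (fun hh => by have := hf.eq_of_window hh (by omega) (by omega); omega)
    (fun hh => hxr hab hh.symm) (fun hh => hyr hab hh.symm) hxy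
  rw [hf.deg_eq (i + 1) b, hf.deg_eq (i + 1) (f (i + 1)), hf.deg_eq (i + 1) (f (j + 1))] at hsum
  have hcard := hf.card_eq
  have hoff : (offNbrs G f b).card + (offNbrs G f (f (i + 1))).card +
      (offNbrs G f (f (j + 1))).card ≤ (((offVerts f).erase b).erase u).card := by
    have hconn : ∀ {r}, Off f r → G.Adj b r → OffConn G f a r := fun hr hbr =>
      hab.trans (.of_adj hb_off hr hbr)
    apply card_add_three_le
    · intro r hr
      rw [mem_offNbrs] at hr
      refine Finset.mem_erase.2 ⟨?_, Finset.mem_erase.2 ⟨hr.2.ne', mem_offVerts.2 hr.1⟩⟩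
      rintro rfl
      exact h.not_adj_off hσ hb_off hr.2.symm
    · intro r hr
      rw [mem_offNbrs] at hr
      refine Finset.mem_erase.2 ⟨?_, Finset.mem_erase.2 ⟨?_, mem_offVerts.2 hr.1⟩⟩
      · rintro rfl
        exact h.off_not_adj_pred hσ ha_off (by omega) (by omega) hr.2.symm
          (by simpa using hai.symm)
      · rintro rfl
        exact hxr hab hr.2
    · intro r hr
      rw [mem_offNbrs] at hr
      refine Finset.mem_erase.2 ⟨?_, Finset.mem_erase.2 ⟨?_, mem_offVerts.2 hr.1⟩⟩
      · rintro rfl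
        by_cases hjL : j = L - 1
        · rw [hjL, show L - 1 + 1 = 0 + L by ring, hf.per] at hr
          exact h.not_adj_zero hr.2.symm
        · exact h.off_not_adj_pred hσ hb_off (by omega) (by omega) hr.2.symm
            (by simpa using hbj.symm)
      · rintro rfl
        exact hyr hab hr.2
    · intro r hr hr'
      rw [mem_offNbrs] at hr hr'
      exact hxr (hconn hr.1 hr.2) hr'.2
    · intro r hr hr'
      rw [mem_offNbrs] at hr hr'
      exact hyr (hconn hr.1 hr.2) hr'.2
    · intro r hr hr'
      rw [mem_offNbrs] at hr hr'
      exact hf.not_cross_vertex hk hr.1 (fun hh => hxr hh hr.2) le_rfl le_rfl (by omega)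
        (by omega) (by omega) hai hbj hr.2 hr'.2
  rw [Finset.card_erase_of_mem (Finset.mem_erase.2 ⟨hbu.symm, mem_offVerts.2 h.off⟩),
    Finset.card_erase_of_mem (mem_offVerts.2 hb_off)] at hoff
  have h2 : 1 < (offVerts f).card := Finset.one_lt_card.2
    ⟨u, mem_offVerts.2 h.off, b, mem_offVerts.2 hb_off, hbu.symm⟩
  obtain ⟨l, hl1, hl2, hl3, hl4⟩ := h.exists_free_index hσ hab hne hi hij hj hai hbj
  set X := nbrIdx G L f (i + 1) (f (i + 1)) with hX
  set Y := nbrIdx G L f (i + 1) (f (j + 1)) with hY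
  set E := nbrIdx G L f (i + 1) b with hE
  have arc1 : (Y.filter (· ≤ j)).card + (X.filter (· ≤ j)).card + (E.filter (· < j)).card ≤
      (Finset.Icc (i + 1) j).card := by
    apply card_add_three_le_of_shift (-1) 1
    · intro z hz
      simp only [hY, Finset.mem_filter, mem_nbrIdx, Finset.mem_Icc] at hz ⊢
      omega
    · intro z hz
      simp only [hX, Finset.mem_filter, mem_nbrIdx, Finset.mem_Icc] at hz ⊢
      have : z ≠ i + 1 := by rintro rfl; exact hz.1.2.ne rfl
      omega
    · intro z hz
      simp only [hE, Finset.mem_filter, mem_nbrIdx, Finset.mem_Icc] at hz ⊢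
      omega
    · intro z hz hz'
      simp only [hX, hY, Finset.mem_filter, mem_nbrIdx] at hz hz'
      exact hf.not_hop hk (i := i) (j := j) (z := z + -1) (z' := z) (by omega) (by omega)
        (by omega) (by omega) (by omega) hai hbj hz.1.2 hz'.1.2
    · intro z hz hz'
      simp only [hE, hY, Finset.mem_filter, mem_nbrIdx] at hz hz'
      exact hf.not_cross_edge (hasPath_single hb_off) (i := z) (j := j) le_rfl le_rfl (by omega)
        (by omega) (by omega) hz.1.2.symm hbj hz'.1.2.symm
    · intro z hz hz'
      simp only [hE, hX, Finset.mem_filter, mem_nbrIdx] at hz hz'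
      have := hf.not_cross_edge hk (i := i) (j := z) (s := 1) (t := 2) le_rfl (by omega) (by omega)
        (by omega) (by omega) hai hz.1.2.symm
      exact this (by rw [show z + 2 = z + 1 - -1 by ring]; exact hz'.1.2)
  have arc2 : (X.filter (¬ · ≤ j)).card + (Y.filter (¬ · ≤ j)).card + ({l} : Finset ℤ).card ≤
      (Finset.Icc (j + 1) (i + L)).card := by
    apply card_add_three_le_of_shift (-1) 0
    · intro z hz
      simp only [hX, Finset.mem_filter, mem_nbrIdx, Finset.mem_Icc] at hz ⊢
      omega
    · intro z hz
      simp only [hY, Finset.mem_filter, mem_nbrIdx, Finset.mem_Icc] at hz ⊢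
      have : z ≠ j + 1 := by rintro rfl; exact hz.1.2.ne rfl
      omega
    · intro z hz
      simp only [Finset.mem_singleton, Finset.mem_Icc] at hz ⊢
      omega
    · intro z hz hz'
      simp only [hX, hY, Finset.mem_filter, mem_nbrIdx] at hz hz'
      exact hf.not_hop hk.symm (i := j) (j := i + L) (z := z + -1) (z' := z) (by omega) (by omega)
        (by omega) (by omega) (by omega) hbj haL hz.1.2 (by rw [← hx]; exact hz'.1.2)
    · intro z hz hz'
      simp only [hX, Finset.mem_filter, Finset.mem_singleton, mem_nbrIdx] at hz hz'
      subst hz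
      exact hl3 (by simpa using hz'.1.2)
    · intro z hz hz'
      simp only [hY, Finset.mem_filter, Finset.mem_singleton, mem_nbrIdx] at hz hz'
      subst hz
      exact hl4 (by simpa using hz'.1.2)
  have hE2 : (E.filter (¬ · < j)).card ≤ ({j, i + L} : Finset ℤ).card := by
    apply Finset.card_le_card
    intro z hz
    simp only [hE, Finset.mem_filter, mem_nbrIdx, Finset.mem_insert, Finset.mem_singleton] at hz ⊢
    by_contra hcon
    exact hb z (by omega) (by omega) hz.1.2
  have hE3 : ({j, i + L} : Finset ℤ).card ≤ 2 := Finset.card_le_two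
  rw [Int.card_Icc] at arc1 arc2
  rw [Finset.card_singleton] at arc2
  have hXs := X.card_filter_add_card_filter_not (· ≤ j)
  have hYs := Y.card_filter_add_card_filter_not (· ≤ j)
  have hEs := E.card_filter_add_card_filter_not (· < j)
  omega

theorem exists_attachments [Fintype V] (hG : OneTough G)
    (h : IsSpecial G L f u) {w w' : V} (hw : Off f w) (hw' : Off f w') (hww : G.Adj w w') :
    ∃ a b p q, OffConn G f a b ∧ a ≠ b ∧ p ≠ q ∧ p ∈ nbrIdx G L f 0 a ∧ q ∈ nbrIdx G L f 0 b := by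
  have hf := h.isLongest
  have hL := h.four_le
  have attach : ∀ s, ∃ a p, OffConn G f w a ∧ p ∈ nbrIdx G L f 0 a ∧ a ≠ s ∧ f p ≠ s := by
    intro s
    have h1 : ∃ x, OffConn G f w x ∧ x ≠ s := by
      by_cases hs : w = s
      · exact ⟨w', .of_adj hw hw' hww, fun hh => hww.ne (hs.trans hh.symm)⟩
      · exact ⟨w, .refl hw, hs⟩
    have h2 : ∃ z, f z ≠ s := by
      by_cases hs : f 0 = s
      · refine ⟨1, fun hh => ?_⟩
        have := hf.eq_of_window (hh.trans hs.symm) (by omega) (by omega)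
        omega
      · exact ⟨0, hs⟩
    obtain ⟨x, hx, hxs⟩ := h1
    obtain ⟨z, hz⟩ := h2
    obtain ⟨a, y, ha, hy, has, hys, hay⟩ := hG.exists_adj s (P := OffConn G f w) hx
      (fun hh => hh.off_right z rfl) hxs hz
    have : ¬ Off f y := fun hyo => hy (ha.trans (.of_adj ha.off_right hyo hay))
    simp only [Off, not_forall, not_not] at this
    obtain ⟨t, rfl⟩ := this
    obtain ⟨p, hp1, hp2, hp3⟩ := hf.window 0 t
    exact ⟨a, p, ha, mem_nbrIdx.2 ⟨⟨hp1, hp2⟩, by rwa [hp3]⟩, has, by rwa [hp3]⟩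
  obtain ⟨a, p, ha, hap, -, -⟩ := attach (f 0)
  obtain ⟨b, q, hb, hbq, hba, -⟩ := attach a
  by_cases hpq : p = q
  · subst hpq
    obtain ⟨c, q, hc, hcq, -, hq⟩ := attach (f p)
    have hpq : p ≠ q := by rintro rfl; exact hq rfl
    by_cases hac : a = c
    · subst hac
      exact ⟨b, a, p, q, hb.symm.trans ha, hba, hpq, hbq, hcq⟩
    · exact ⟨a, c, p, q, ha.symm.trans hc, hac, hpq, hap, hcq⟩
  · exact ⟨a, b, p, q, ha.symm.trans hb, hba.symm, hpq, hap, hbq⟩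

/-- The vertices off the cycle form an independent set. -/
theorem not_adj_of_off [Fintype V] (hσ : DegSumGe G) (hG : OneTough G)
    (h : IsSpecial G L f u) {w w' : V} (hw : Off f w) (hw' : Off f w') : ¬ G.Adj w w' := by
  intro hww
  have hf := h.isLongest
  obtain ⟨a, b, p, q, hab, hne, hpq, hp, hq⟩ := h.exists_attachments hG hw hw' hww
  have hpos : ∀ {x z}, Off f x → z ∈ nbrIdx G L f 0 x → 1 ≤ z ∧ z ≤ L - 1 := by
    intro x z hx hz
    rw [mem_nbrIdx] at hz
    have : z ≠ 0 := by rintro rfl; exact h.zero_not_adj_off hσ hx hz.2.symm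
    omega
  have key : ∀ {a b i j}, OffConn G f a b → a ≠ b → i < j → i ∈ nbrIdx G L f 0 a →
      j ∈ nbrIdx G L f 0 b → (∀ z ∈ nbrIdx G L f 0 b, i ≤ z ∧ z ≤ j) → False := by
    intro a b i j hab hne hij hi hj hb
    have hi' := hpos hab.off_left hi
    have hj' := hpos hab.off_right hj
    refine h.false_of_attachments hσ hab hne hi'.1 hij hj'.2 (mem_nbrIdx.1 hi).2.symm
      (mem_nbrIdx.1 hj).2.symm fun z hz1 hz2 hz => ?_
    by_cases hzL : z < L
    · have := hb z (mem_nbrIdx.2 ⟨by omega, hz⟩)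
      omega
    · have := hb (z - L) (mem_nbrIdx.2 ⟨by omega, by rwa [hf.per']⟩)
      omega
  have key2 : ∀ {a b p q}, OffConn G f a b → a ≠ b → p ≠ q → (hp : p ∈ nbrIdx G L f 0 a) →
      (hq : q ∈ nbrIdx G L f 0 b) →
      (nbrIdx G L f 0 a).min' ⟨p, hp⟩ ≤ (nbrIdx G L f 0 b).min' ⟨q, hq⟩ → False := by
    intro a b p q hab hne hpq hp hq hmin
    have hb : ∀ z ∈ nbrIdx G L f 0 b, (nbrIdx G L f 0 a).min' ⟨p, hp⟩ ≤ z ∧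
        z ≤ (nbrIdx G L f 0 b).max' ⟨q, hq⟩ := fun z hz =>
      ⟨hmin.trans (Finset.min'_le _ _ hz), Finset.le_max' _ _ hz⟩
    by_cases hlt : (nbrIdx G L f 0 a).min' ⟨p, hp⟩ < (nbrIdx G L f 0 b).max' ⟨q, hq⟩
    · exact key hab hne hlt (Finset.min'_mem _ _) (Finset.max'_mem _ _) hb
    · have hqm := hb q hq
      have hpm := Finset.min'_le _ _ hp
      have hpM := Finset.le_max' _ _ hp
      exact key hab.symm hne.symm (i := q) (by omega) hq (Finset.max'_mem _ ⟨p, hp⟩)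
        fun z hz => by
          have := Finset.min'_le _ _ hz
          exact ⟨by omega, Finset.le_max' _ _ hz⟩
  rcases le_total ((nbrIdx G L f 0 a).min' ⟨p, hp⟩) ((nbrIdx G L f 0 b).min' ⟨q, hq⟩) with hle | hle
  · exact key2 hab hne hpq hp hq hle
  · exact key2 hab.symm hne.symm hpq.symm hq hp hle

end IsSpecial

theorem IsLongestParam.window_add {G : SimpleGraph V} {L : ℤ} {f : ℤ → V}
    (hf : IsLongestParam G L f) (α i : ℤ) :
    ∃ j, α ≤ j ∧ j < α + L ∧ ∀ t, f (j + t) = f (i + t) := by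
  have hL := hf.three_le
  refine ⟨α + (i - α) % L, ?_, ?_, fun t => ?_⟩
  · have := Int.emod_nonneg (i - α) (show L ≠ 0 by omega); omega
  · have := Int.emod_lt_of_pos (i - α) (show 0 < L by omega); omega
  · rw [← hf.per_mul _ ((i - α) / L)]
    congr 1
    have := Int.emod_add_mul_ediv (i - α) L
    linarith [mul_comm L ((i - α) / L)]

theorem IsLongestParam.isSpecial_shift {G : SimpleGraph V} {L : ℤ} {f : ℤ → V}
    (hf : IsLongestParam G L f) {u : V} (hu : Off f u) {m : ℤ} (h1 : G.Adj u (f (m - 1)))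
    (h2 : G.Adj u (f (m + 1))) : IsSpecial G L (fun i => f (i + m)) u where
  isLongest := hf.shift m
  off z := hu (z + m)
  adj_one := by rwa [add_comm 1 m]
  adj_neg_one := by rwa [show -1 + m = m - 1 by ring]

/-- `f i` is the successor of a neighbor of `u`, or of a neighbor of a cycle vertex both of whose
cycle neighbors are adjacent to `u`. -/
def SuccNbr (G : SimpleGraph V) (f : ℤ → V) (u : V) (i : ℤ) : Prop :=
  G.Adj u (f (i - 1)) ∨
    ∃ m, G.Adj u (f (m - 1)) ∧ G.Adj u (f (m + 1)) ∧ G.Adj (f m) (f (i - 1))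

namespace IsSpecial

variable {G : SimpleGraph V} {L : ℤ} {f : ℤ → V} {u : V}

theorem period (h : IsSpecial G L f u) : f L = f 0 := by simpa using h.isLongest.per 0

theorem off_not_adj_nbr_succ [Fintype V] (hσ : DegSumGe G) (h : IsSpecial G L f u) {p : ℤ}
    {r : V} (hr : Off f r) (hup : G.Adj u (f p)) : ¬ G.Adj r (f (p + 1)) := by
  obtain ⟨q, hq1, hq2, hq⟩ := h.isLongest.window_add 0 p
  have hq0 := hq 0
  rw [add_zero, add_zero] at hq0
  rw [← hq0] at hup
  rw [← hq 1]
  have : q ≠ 0 := by rintro rfl; exact h.not_adj_zero hup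
  by_cases hqL : q = L - 1
  · rw [hqL, show L - 1 + 1 = L by ring, h.period]
    exact fun hh => h.zero_not_adj_off hσ hr hh.symm
  · exact h.off_not_adj_succ hσ hr (by omega) (by omega) hup

theorem off_not_adj_zero_nbr_succ [Fintype V] (hσ : DegSumGe G) (h : IsSpecial G L f u) {y : ℤ}
    {r : V} (hr : Off f r) (h0y : G.Adj (f 0) (f y)) : ¬ G.Adj r (f (y + 1)) := by
  obtain ⟨q, hq1, hq2, hq⟩ := h.isLongest.window_add 0 y
  have hq0 := hq 0
  rw [add_zero, add_zero] at hq0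
  rw [← hq0] at h0y
  rw [← hq 1]
  have : q ≠ 0 := by rintro rfl; exact h0y.ne rfl
  by_cases hqL : q = L - 1
  · rw [hqL, show L - 1 + 1 = L by ring, h.period]
    exact fun hh => h.zero_not_adj_off hσ hr hh.symm
  · exact h.off_not_adj_zero_succ hσ hr (by omega) (by omega) h0y

theorem nbr_succ_not_adj_nbr_succ (h : IsSpecial G L f u) {p q : ℤ} (hp : G.Adj u (f p))
    (hq : G.Adj u (f q)) : ¬ G.Adj (f (p + 1)) (f (q + 1)) := by
  obtain ⟨r, hr1, hr2, hr⟩ := h.isLongest.window_add p q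
  have hr0 := hr 0
  rw [add_zero, add_zero] at hr0
  rw [← hr0] at hq
  rw [← hr 1]
  by_cases hpr : r = p
  · subst hpr
    exact G.irrefl
  · exact h.isLongest.not_cross_edge (hasPath_single h.off) le_rfl le_rfl (by omega) (by omega)
      (by omega) hp.symm hq.symm

theorem nbr_succ_not_adj_zero_nbr_succ (h : IsSpecial G L f u) {p y : ℤ} (hp : G.Adj u (f p))
    (hy : G.Adj (f 0) (f y)) : ¬ G.Adj (f (p + 1)) (f (y + 1)) := by
  have hf := h.isLongest
  have hL := h.four_le
  obtain ⟨p', hp1, hp2, hpp⟩ := hf.window_add 0 p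
  obtain ⟨y', hy1, hy2, hyy⟩ := hf.window_add 0 y
  have hp0 := hpp 0
  have hy0 := hyy 0
  rw [add_zero, add_zero] at hp0 hy0
  rw [← hp0] at hp
  rw [← hy0] at hy
  rw [← hpp 1, ← hyy 1]
  clear hp0 hy0 hpp hyy
  have : p' ≠ 0 := by rintro rfl; exact h.not_adj_zero hp
  have : y' ≠ 0 := by rintro rfl; exact hy.ne rfl
  by_cases hpL : p' = L - 1
  · subst hpL
    rw [show L - 1 + 1 = L by ring, h.period]
    by_cases hyL : y' = L - 1
    · subst hyL
      rw [show L - 1 + 1 = L by ring, h.period]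
      exact G.irrefl
    · exact h.zero_not_adj_succ (by omega) (by omega) hy
  by_cases hyL : y' = L - 1
  · subst hyL
    rw [show L - 1 + 1 = L by ring, h.period, G.adj_comm]
    exact h.not_adj_zero_succ (by omega) (by omega) hp
  intro hpy
  rcases lt_trichotomy p' y' with hlt | rfl | hlt
  · exact hf.not_hop (hasPath_single h.off) (i := p') (j := L - 1) (z := y') (z' := y' + 1)
      (by omega) (by omega) (by omega) (by omega) (by omega) hp.symm h.adj_pred.symm hpy
      (by rwa [show L - 1 + 1 = L by ring, h.period])
  · exact hpy.ne rfl
  · have hs := h.swap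
    refine hs.isLongest.not_hop (hasPath_single hs.off) (i := y') (j := L - 1) (z := p')
      (z' := p' + 1) (by omega) (by omega) (by omega) (by omega) (by omega) ?_ hs.adj_pred.symm
      ?_ ?_
    · rw [swap_of_lt (by omega) (by omega)]
      exact hy.symm
    · rw [swap_of_lt (by omega) (by omega), swap_of_lt (by omega) (by omega)]
      exact hpy.symm
    · rw [show L - 1 + 1 = L by ring, swap_period, swap_of_lt (by omega) (by omega)]
      exact hp

theorem zero_nbr_succ_not_adj_zero_nbr_succ (h : IsSpecial G L f u) {y z : ℤ}
    (hy : G.Adj (f 0) (f y)) (hz : G.Adj (f 0) (f z)) : ¬ G.Adj (f (y + 1)) (f (z + 1)) := by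
  by_cases hy0 : f (y + 1) = f 0
  · rw [hy0]
    have := h.nbr_succ_not_adj_zero_nbr_succ h.adj_neg_one hz
    simpa using this
  by_cases hz0 : f (z + 1) = f 0
  · rw [hz0, G.adj_comm]
    have := h.nbr_succ_not_adj_zero_nbr_succ h.adj_neg_one hy
    simpa using this
  have := h.swap.nbr_succ_not_adj_nbr_succ (p := y) (q := z) (by rwa [h.swap_eq hy.ne'])
    (by rwa [h.swap_eq hz.ne'])
  rwa [h.swap_eq hy0, h.swap_eq hz0] at this

theorem not_adj_of_lt_special (h : IsSpecial G L f u) {m y z : ℤ} (hm1 : G.Adj u (f (m - 1)))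
    (hm2 : G.Adj u (f (m + 1))) (hmL : m ≤ L - 2) (hy : G.Adj (f 0) (f y))
    (hz : G.Adj (f m) (f z)) (hy1 : 1 ≤ y) (hyL : y ≤ L - 2) (hz1 : 1 ≤ z) (hzL : z ≤ L - 2)
    (hym : y ≠ m - 1) (hym' : y ≠ m) (hzm : z ≠ m - 1) (hzm' : z ≠ m) (hyz : y < m ∨ z < m)
    (hne : y ≠ z) : ¬ G.Adj (f (y + 1)) (f (z + 1)) := by
  intro hadj
  have hf := h.isLongest
  have hL := h.four_le
  have hLy : G.Adj (f L) (f y) := by rwa [h.period]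
  have hu := hasPath_single (G := G) h.off
  have seg : ∀ {i j}, i ≤ j → 0 ≤ i → j ≤ L → (i = 0 → j < L) →
      HasPath G f (fun z => i ≤ z ∧ z ≤ j) (fun _ => False) (j - i + 1) (f i) (f j) :=
    fun h1 h2 h3 h4 => hf.hasPath_arc h1 (by omega)
  by_cases hym2 : y < m
  · by_cases hzm2 : z < m
    · by_cases hyz : y < z
      · have A := hf.hasPath_append (seg (i := y + 1) (j := z) (by omega) (by omega) (by omega)
          (by omega)) hz.symm (seg (i := m) (j := L) (by omega) (by omega) (by omega) (by omega))
          (by intro z z' hz hz'; omega) (by simp)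
        have B := hf.hasPath_append A hLy (seg (i := 1) (j := y) (by omega) (by omega) (by omega)
          (by omega)).symm (by intro z z' hz hz'; omega) (by simp)
        have C := hf.hasPath_append B h.adj_one.symm hu (by simp) (by simp)
        have D := hf.hasPath_append C hm1 (seg (i := z + 1) (j := m - 1) (by omega) (by omega)
          (by omega) (by omega)).symm (by intro z z' hz hz'; simp only [or_false] at hz; omega)
          (by simp)
        have := hf.le_of_hasPath D hadj.symm
        omega
      · have A := hf.hasPath_append (seg (i := z + 1) (j := y) (by omega) (by omega) (by omega)
          (by omega)) hy.symm (seg (i := 0) (j := z) (by omega) (by omega) (by omega) (by omega))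
          (by intro z z' hz hz'; omega) (by simp)
        have B := hf.hasPath_append A hz.symm (seg (i := m) (j := L - 1) (by omega) (by omega)
          (by omega) (by omega)) (by intro z z' hz hz'; omega) (by simp)
        have C := hf.hasPath_append B h.adj_pred.symm hu (by simp) (by simp)
        have D := hf.hasPath_append C hm1 (seg (i := y + 1) (j := m - 1) (by omega) (by omega)
          (by omega) (by omega)).symm (by intro z z' hz hz'; simp only [or_false] at hz; omega)
          (by simp)
        have := hf.le_of_hasPath D hadj
        omega
    · have A := hf.hasPath_append (seg (i := y + 1) (j := m) (by omega) (by omega) (by omega)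
          (by omega)).symm hadj (seg (i := z + 1) (j := L) (by omega) (by omega) (by omega)
          (by omega)) (by intro z z' hz hz'; omega) (by simp)
      have B := hf.hasPath_append A hLy (seg (i := 1) (j := y) (by omega) (by omega) (by omega)
          (by omega)).symm (by intro z z' hz hz'; omega) (by simp)
      have C := hf.hasPath_append B h.adj_one.symm hu (by simp) (by simp)
      have D := hf.hasPath_append C hm2 (seg (i := m + 1) (j := z) (by omega) (by omega)
          (by omega) (by omega)) (by intro z z' hz hz'; simp only [or_false] at hz; omega)
          (by simp)
      have := hf.le_of_hasPath D hz.symm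
      omega
  · have A := hf.hasPath_append (seg (i := z + 1) (j := m) (by omega) (by omega) (by omega)
        (by omega)).symm hadj.symm (seg (i := y + 1) (j := L) (by omega) (by omega) (by omega)
        (by omega)) (by intro z z' hz hz'; omega) (by simp)
    have B := hf.hasPath_append A hLy (seg (i := m + 1) (j := y) (by omega) (by omega) (by omega)
        (by omega)).symm (by intro z z' hz hz'; omega) (by simp)
    have C := hf.hasPath_append B hm2.symm hu (by simp) (by simp)
    have D := hf.hasPath_append C h.adj_one (seg (i := 1) (j := z) (by omega) (by omega)
        (by omega) (by omega)) (by intro z z' hz hz'; simp only [or_false] at hz; omega)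
        (by simp)
    have := hf.le_of_hasPath D hz.symm
    omega

theorem zero_nbr_succ_not_adj_special_nbr_succ (h : IsSpecial G L f u) {m y z : ℤ}
    (hm1 : G.Adj u (f (m - 1))) (hm2 : G.Adj u (f (m + 1))) (hy : G.Adj (f 0) (f y))
    (hz : G.Adj (f m) (f z)) : ¬ G.Adj (f (y + 1)) (f (z + 1)) := by
  have hf := h.isLongest
  have hL := h.four_le
  obtain ⟨m', h1, h2, hmm⟩ := hf.window_add 0 m
  have hmm0 := hmm 0
  rw [add_zero, add_zero] at hmm0
  rw [← hmm 1] at hm2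
  rw [sub_eq_add_neg, ← hmm (-1), ← sub_eq_add_neg] at hm1
  rw [← hmm0] at hz
  clear hmm hmm0
  obtain ⟨y', hy1, hy2, hyy⟩ := hf.window_add 0 y
  obtain ⟨z', hz1, hz2, hzz⟩ := hf.window_add 0 z
  have hy0 := hyy 0
  have hz0 := hzz 0
  rw [add_zero, add_zero] at hy0 hz0
  rw [← hy0] at hy
  rw [← hz0] at hz
  rw [← hyy 1, ← hzz 1]
  clear hyy hy0 hzz hz0
  by_cases hm0 : m' = 0
  · subst hm0
    exact h.zero_nbr_succ_not_adj_zero_nbr_succ hy hz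
  have : m' ≠ 1 := by
    rintro rfl
    exact h.not_adj_zero (by simpa using hm1)
  have : m' ≠ L - 1 := by
    rintro rfl
    exact h.not_adj_zero (by simpa [h.period] using hm2)
  have h0m : ¬ G.Adj (f 0) (f m') := by
    have := h.not_adj_zero_succ (z := m' - 1) (by omega) (by omega) hm1
    simpa using this
  have : y' ≠ 0 := by rintro rfl; exact hy.ne rfl
  have : y' ≠ m' := by rintro rfl; exact h0m hy
  have : z' ≠ 0 := by rintro rfl; exact h0m hz.symm
  have : z' ≠ m' := by rintro rfl; exact hz.ne rfl
  have hs := hf.isSpecial_shift h.off hm1 hm2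
  have key : ∀ {p}, G.Adj u (f p) → ¬ G.Adj (f (p + 1)) (f (z' + 1)) := by
    intro p hp
    have := hs.nbr_succ_not_adj_zero_nbr_succ (p := p - m') (y := z' - m') (by simpa using hp)
      (by simpa using hz)
    simpa [show p - m' + 1 + m' = p + 1 by ring, show z' - m' + 1 + m' = z' + 1 by ring] using this
  have key2 : ∀ {p}, G.Adj u (f p) → ¬ G.Adj (f (y' + 1)) (f (p + 1)) := by
    intro p hp
    rw [G.adj_comm]
    exact h.nbr_succ_not_adj_zero_nbr_succ hp hy
  by_cases hyL : y' = L - 1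
  · subst hyL
    exact key h.adj_pred
  by_cases hzL : z' = L - 1
  · subst hzL
    exact key2 h.adj_pred
  by_cases hym : y' = m' - 1
  · subst hym
    exact key hm1
  by_cases hzm : z' = m' - 1
  · subst hzm
    exact key2 hm1
  by_cases hyz : y' = z'
  · subst hyz
    exact G.irrefl
  by_cases hlt : y' < m' ∨ z' < m'
  · exact h.not_adj_of_lt_special hm1 hm2 (by omega) hy hz (by omega) (by omega) (by omega)
      (by omega) hym (by omega) hzm (by omega) hlt hyz
  · have := hs.not_adj_of_lt_special (m := L - m') (y := z' - m') (z := y' - m')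
      (by simpa [show L - m' - 1 + m' = L - 1 by ring] using h.adj_pred)
      (by
        have := hf.per 1
        simpa [show L - m' + 1 + m' = 1 + L by ring, this] using h.adj_one)
      (by omega) (by simpa using hz) (by simpa [h.period] using hy) (by omega) (by omega)
      (by omega) (by omega) (by omega) (by omega) (by omega) (by omega) (by omega) (by omega)
    rw [G.adj_comm]
    simpa [show y' - m' + 1 + m' = y' + 1 by ring, show z' - m' + 1 + m' = z' + 1 by ring]
      using this

theorem off_not_adj_succNbr [Fintype V] (hσ : DegSumGe G) (h : IsSpecial G L f u) {r : V}
    (hr : Off f r) {i : ℤ} (hi : SuccNbr G f u i) : ¬ G.Adj r (f i) := by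
  rcases hi with hi | ⟨m, h1, h2, h3⟩
  · simpa using h.off_not_adj_nbr_succ hσ hr hi
  · have := (h.isLongest.isSpecial_shift h.off h1 h2).off_not_adj_zero_nbr_succ hσ (r := r)
      (fun z => hr _) (y := i - 1 - m) (by simpa using h3)
    simpa [show i - 1 - m + 1 + m = i by ring] using this

theorem succNbr_not_adj_succNbr (h : IsSpecial G L f u) {i j : ℤ} (hi : SuccNbr G f u i)
    (hj : SuccNbr G f u j) : ¬ G.Adj (f i) (f j) := by
  have hf := h.isLongest
  have mixed : ∀ {i j m}, G.Adj u (f (i - 1)) → G.Adj u (f (m - 1)) → G.Adj u (f (m + 1)) →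
      G.Adj (f m) (f (j - 1)) → ¬ G.Adj (f i) (f j) := by
    intro i j m hi h1 h2 h3
    have := (hf.isSpecial_shift h.off h1 h2).nbr_succ_not_adj_zero_nbr_succ (p := i - 1 - m)
      (y := j - 1 - m) (by simpa using hi) (by simpa using h3)
    simpa [show i - 1 - m + 1 + m = i by ring, show j - 1 - m + 1 + m = j by ring] using this
  rcases hi with hi | ⟨m, h1, h2, h3⟩ <;> rcases hj with hj | ⟨m', h1', h2', h3'⟩
  · simpa using h.nbr_succ_not_adj_nbr_succ hi hj
  · exact mixed hi h1' h2' h3'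
  · rw [G.adj_comm]
    exact mixed hj h1 h2 h3
  · have := (hf.isSpecial_shift h.off h1 h2).zero_nbr_succ_not_adj_special_nbr_succ
      (m := m' - m) (y := i - 1 - m) (z := j - 1 - m)
      (by simpa [show m' - m - 1 + m = m' - 1 by ring] using h1')
      (by simpa [show m' - m + 1 + m = m' + 1 by ring] using h2')
      (by simpa using h3) (by simpa using h3')
    simpa [show i - 1 - m + 1 + m = i by ring, show j - 1 - m + 1 + m = j by ring] using this

end IsSpecial

theorem IsSpecial.isIndepSet [Fintype V] {G : SimpleGraph V} {L : ℤ} {f : ℤ → V} {u : V}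
    (hσ : DegSumGe G) (hG : OneTough G) (h : IsSpecial G L f u) {next : V → V}
    (hnext : ∀ i, next (f i) = f (i + 1)) (hoff : ∀ x, Off f x → next x = x) {A : Set V}
    (hA : ∀ x ∈ A, ∃ m, f m = x ∧ G.Adj u (f (m - 1)) ∧ G.Adj u (f (m + 1))) :
    IsIndepSet G ({x | Off f x} ∪ next '' G.neighborSet u ∪ next '' nbhdSet G A) := by
  have cover : ∀ x ∈ {x | Off f x} ∪ next '' G.neighborSet u ∪ next '' nbhdSet G A,
      Off f x ∨ ∃ i, SuccNbr G f u i ∧ f i = x := by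
    rintro x ((hx | ⟨y, hy, rfl⟩) | ⟨y, ⟨z, hz, hzy⟩, rfl⟩)
    · exact Or.inl hx
    · by_cases hy' : Off f y
      · rw [hoff y hy']
        exact Or.inl hy'
      · simp only [Off, not_forall, not_not] at hy'
        obtain ⟨p, rfl⟩ := hy'
        exact Or.inr ⟨p + 1, Or.inl (by simpa using hy), (hnext p).symm⟩
    · by_cases hy' : Off f y
      · rw [hoff y hy']
        exact Or.inl hy'
      · simp only [Off, not_forall, not_not] at hy'
        obtain ⟨p, rfl⟩ := hy'
        obtain ⟨m, rfl, h1, h2⟩ := hA z hz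
        exact Or.inr ⟨p + 1, Or.inr ⟨m, h1, h2, by simpa using hzy⟩, (hnext p).symm⟩
  intro x hx y hy
  rcases cover x hx with hx | ⟨i, hi, rfl⟩ <;> rcases cover y hy with hy | ⟨j, hj, rfl⟩
  · exact h.not_adj_of_off hσ hG hx hy
  · exact h.off_not_adj_succNbr hσ hx hj
  · rw [G.adj_comm]
    exact h.off_not_adj_succNbr hσ hy hi
  · exact h.succNbr_not_adj_succNbr hi hj

/-- the periodic parametrization of a closed walk -/
def cycleParam {G : SimpleGraph V} {a : V} (c : G.Walk a a) (i : ℤ) : V :=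
  c.getVert ((i % c.length).toNat + 1)

section cycleParam

variable {G : SimpleGraph V} {a : V} {c : G.Walk a a}

theorem exists_cycleParam_eq (hc : c.IsCycle) (i : ℤ) :
    ∃ k : ℕ, k < c.length ∧ (i % c.length).toNat = k ∧
      ((i + 1) % c.length).toNat = (k + 1) % c.length ∧
      ((i - 1) % c.length).toNat = (k + (c.length - 1)) % c.length := by
  have h3 := hc.three_le_length
  have h1 := Int.emod_nonneg i (show (c.length : ℤ) ≠ 0 by omega)
  have h2 := Int.emod_lt_of_pos i (show (0 : ℤ) < c.length by omega)
  obtain ⟨k, hk⟩ := Int.eq_ofNat_of_zero_le h1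
  refine ⟨k, by omega, by omega, ?_, ?_⟩
  · have : (i + 1) % c.length = (((k + 1) % c.length : ℕ) : ℤ) := by
      push_cast
      rw [← hk]
      simp
    rw [this, Int.toNat_natCast]
  · have : (i - 1) % c.length = (((k + (c.length - 1)) % c.length : ℕ) : ℤ) := by
      push_cast [show 1 ≤ c.length by omega]
      rw [← hk, show i % (c.length : ℤ) + (c.length - 1) = i % c.length - 1 + c.length by ring]
      simp
    rw [this, Int.toNat_natCast]

theorem support_tail_getElem {k : ℕ} (hk : k < c.support.tail.length) :
    c.support.tail[k] = c.getVert (k + 1) := by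
  rw [List.getElem_tail, SimpleGraph.Walk.support_getElem_eq_getVert]

theorem length_support_tail : c.support.tail.length = c.length := by simp

theorem cSucc_cycleParam [DecidableEq V] (hc : c.IsCycle) (i : ℤ) :
    cSucc c (cycleParam c i) = cycleParam c (i + 1) := by
  obtain ⟨k, hk, h1, h2, -⟩ := exists_cycleParam_eq hc i
  have hk' : k < c.support.tail.length := by rwa [length_support_tail]
  rw [cycleParam, cycleParam, h1, h2, ← support_tail_getElem hk', cSucc,
    dif_pos (List.getElem_mem _), List.next_getElem _ hc.support_nodup, support_tail_getElem,
    length_support_tail]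

theorem cPred_cycleParam [DecidableEq V] (hc : c.IsCycle) (i : ℤ) :
    cPred c (cycleParam c i) = cycleParam c (i - 1) := by
  obtain ⟨k, hk, h1, -, h2⟩ := exists_cycleParam_eq hc i
  have hk' : k < c.support.tail.length := by rwa [length_support_tail]
  rw [cycleParam, cycleParam, h1, h2, ← support_tail_getElem hk', cPred,
    dif_pos (List.getElem_mem _), List.prev_getElem _ hc.support_nodup, support_tail_getElem,
    length_support_tail]

theorem mem_support_iff_exists_cycleParam (hc : c.IsCycle) {x : V} :
    x ∈ c.support ↔ ∃ i, cycleParam c i = x := by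
  have h3 := hc.three_le_length
  constructor
  · intro hx
    obtain ⟨n, rfl, hn⟩ := SimpleGraph.Walk.mem_support_iff_exists_getVert.1 hx
    rcases n with _ | n
    · refine ⟨(c.length - 1 : ℕ), ?_⟩
      rw [cycleParam, Int.emod_eq_of_lt (by omega) (by omega), Int.toNat_natCast,
        Nat.sub_add_cancel (by omega)]
      simp
    · refine ⟨n, ?_⟩
      rw [cycleParam, Int.emod_eq_of_lt (by omega) (by omega), Int.toNat_natCast]
  · rintro ⟨i, rfl⟩
    exact c.getVert_mem_support _

theorem off_cycleParam_iff (hc : c.IsCycle) {x : V} : Off (cycleParam c) x ↔ x ∉ c.support := by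
  rw [mem_support_iff_exists_cycleParam hc, not_exists]
  rfl

theorem IsLongestCycle.isLongestParam (hc : IsLongestCycle G c) :
    IsLongestParam G c.length (cycleParam c) where
  three_le := by exact_mod_cast hc.1.three_le_length
  adj i := by
    obtain ⟨k, hk, h1, h2, -⟩ := exists_cycleParam_eq hc.1 i
    rw [cycleParam, cycleParam, h1, h2]
    by_cases hkL : k + 1 < c.length
    · rw [Nat.mod_eq_of_lt hkL]
      exact c.adj_getVert_succ hkL
    · have hkL' : k + 1 = c.length := by omega
      rw [hkL', Nat.mod_self, c.getVert_length]
      have := c.adj_getVert_succ (i := 0) (by omega)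
      simpa using this
  per i := by simp [cycleParam]
  inj i j h := by
    obtain ⟨k, hk, h1, -, -⟩ := exists_cycleParam_eq hc.1 i
    obtain ⟨l, hl, h1', -, -⟩ := exists_cycleParam_eq hc.1 j
    have hkl := hc.1.getVert_injOn (by simp; omega) (by simp; omega) h
    have hi := Int.emod_nonneg i (show (c.length : ℤ) ≠ 0 by omega)
    have hj := Int.emod_nonneg j (show (c.length : ℤ) ≠ 0 by omega)
    exact Int.ModEq.dvd (show j % c.length = i % c.length by omega)
  le b w hw := by exact_mod_cast hc.2 b w hw

end cycleParam

theorem stmt5 {V : Type*} [Fintype V] [DecidableEq V] (G : SimpleGraph V)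
    (hn : 3 ≤ Fintype.card V) (htough : OneTough G) (hsig : Fintype.card V ≤ sigma3 G)
    (hham : ¬ G.IsHamiltonian) {a : V} (c : G.Walk a a) (hc : IsLongestCycle G c)
    (u v : V) (hu : u ∉ c.support) (hv : v ∈ c.support)
    (huv1 : G.Adj u (cSucc c v)) (huv2 : G.Adj u (cPred c v))
    (A : Set V)
    (hA : A = {x | x ∈ c.support ∧ cPred c x ∈ G.neighborSet u ∧ cSucc c x ∈ G.neighborSet u}) :
    IsIndepSet G ({x | x ∉ c.support} ∪ cSucc c '' G.neighborSet u ∪ cSucc c '' nbhdSet G A) ∧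
    IsIndepSet G ({x | x ∉ c.support} ∪ cPred c '' G.neighborSet u ∪ cPred c '' nbhdSet G A) := by
  have hσ := degSumGe_of_le_sigma3 hsig
  have hf := hc.isLongestParam
  have huo := (off_cycleParam_iff hc.1).2 hu
  have hsucc := cSucc_cycleParam hc.1
  have hpred := cPred_cycleParam hc.1
  have hmem := fun x => mem_support_iff_exists_cycleParam hc.1 (x := x)
  obtain ⟨m, rfl⟩ := (hmem v).1 hv
  rw [hsucc] at huv1
  rw [hpred] at huv2
  have h := hf.isSpecial_shift huo huv2 huv1
  set f := cycleParam c with hf_def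
  have hsucc_off : ∀ x, x ∉ c.support → cSucc c x = x := fun x hx =>
    dif_neg fun hh => hx (List.mem_of_mem_tail hh)
  have hpred_off : ∀ x, x ∉ c.support → cPred c x = x := fun x hx =>
    dif_neg fun hh => hx (List.mem_of_mem_tail hh)
  have hoff : ∀ x, Off (fun i => f (i + m)) x ↔ x ∉ c.support := fun x => by
    rw [← off_cycleParam_iff hc.1]
    exact ⟨fun hx z => by simpa using hx (z - m), fun hx z => hx (z + m)⟩
  have hoff' : ∀ x, Off (fun i => f (-i + m)) x ↔ x ∉ c.support := fun x => by
    rw [← off_cycleParam_iff hc.1]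
    exact ⟨fun hx z => by simpa using hx (m - z), fun hx z => hx (-z + m)⟩
  have hA' : ∀ x ∈ A, ∃ i, f i = x ∧ G.Adj u (f (i - 1)) ∧ G.Adj u (f (i + 1)) := by
    intro x hx
    rw [hA] at hx
    obtain ⟨hxc, h1, h2⟩ := hx
    obtain ⟨i, rfl⟩ := (hmem x).1 hxc
    exact ⟨i, rfl, by rwa [hpred] at h1, by rwa [hsucc] at h2⟩
  constructor
  · have := h.isIndepSet hσ htough (next := cSucc c) (A := A)
      (fun i => by rw [hsucc]; congr 1; ring) (fun x hx => hsucc_off x ((hoff x).1 hx))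
      (fun x hx => by
        obtain ⟨i, hi, h1, h2⟩ := hA' x hx
        exact ⟨i - m, by simpa using hi, by rwa [show i - m - 1 + m = i - 1 by ring],
          by rwa [show i - m + 1 + m = i + 1 by ring]⟩)
    simpa only [hoff] using this
  · have := h.reflect.isIndepSet hσ htough (next := cPred c) (A := A)
      (fun i => by rw [hpred]; congr 1; ring) (fun x hx => hpred_off x ((hoff' x).1 hx))
      (fun x hx => by
        obtain ⟨i, hi, h1, h2⟩ := hA' x hx
        exact ⟨m - i, by simpa using hi, by rwa [show -(m - i - 1) + m = i + 1 by ring],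
          by rwa [show -(m - i + 1) + m = i - 1 by ring]⟩)
    simpa only [hoff'] using this

end
end Paper
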